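/- Let g ≥ 2 be an integer, let T be the surface group of genus g, and let p be a prime. Suppose φ is an automorphism of T such that φ(N) = N for every normal subgroup N of T whose index is a power of p. Then φ is an inner automorphism, i.e., there exists t ∈ T such that φ(x) = t * x * t⁻¹ for all x ∈ T. -/

import Mathlib

/-- The surface relator `∏ i, [aᵢ, bᵢ]` in the free group on `2g` generators,
where the generator `(i, true)` is `aᵢ` and `(i, false)` is `bᵢ`. -/
def surfaceRel (g : ℕ) : FreeGroup (Fin g × Bool) :=
  (List.ofFn fun i : Fin g =>
    FreeGroup.of (i, true) * FreeGroup.of (i, false) *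
      (FreeGroup.of (i, true))⁻¹ * (FreeGroup.of (i, false))⁻¹).prod

/-- The surface group of genus `g`: the presented group on generators
`a₁, b₁, …, a_g, b_g` with the single relator `∏ i, aᵢ bᵢ aᵢ⁻¹ bᵢ⁻¹`. -/
def SurfaceGroup (g : ℕ) : Type :=
  PresentedGroup ({surfaceRel g} : Set (FreeGroup (Fin g × Bool)))

instance (g : ℕ) : Group (SurfaceGroup g) :=
  inferInstanceAs (Group (PresentedGroup _))

/-- The value `∏ i, [y (i, true), y (i, false)]` of the surface relator on a tuple of group
elements. -/
def surfaceWord {H : Type*} [Group H] {g : ℕ} (y : Fin g × Bool → H) : H :=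
  (List.ofFn fun i : Fin g => y (i, true) * y (i, false) * (y (i, true))⁻¹ * (y (i, false))⁻¹).prod

theorem map_surfaceWord {H K : Type*} [Group H] [Group K] {g : ℕ} (f : H →* K)
    (y : Fin g × Bool → H) : f (surfaceWord y) = surfaceWord (fun x => f (y x)) := by
  simp [surfaceWord, map_list_prod, List.map_ofFn, Function.comp_def]

theorem surfaceWord_mem {H : Type*} [Group H] {g : ℕ} {y : Fin g × Bool → H} {K : Submonoid H}
    (h : ∀ i, y (i, true) * y (i, false) * (y (i, true))⁻¹ * (y (i, false))⁻¹ ∈ K) :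
    surfaceWord y ∈ K := by
  refine Submonoid.list_prod_mem _ fun x hx => ?_
  obtain ⟨i, rfl⟩ := (List.mem_ofFn' _ _).1 hx
  exact h i

theorem surfaceWord_eq_one {H : Type*} [Group H] {g : ℕ} {y : Fin g × Bool → H}
    (h : ∀ i, y (i, true) * y (i, false) * (y (i, true))⁻¹ * (y (i, false))⁻¹ = 1) :
    surfaceWord y = 1 :=
  Submonoid.mem_bot.1 (surfaceWord_mem fun i => Submonoid.mem_bot.2 (h i))

theorem surfaceWord_of_comm {H : Type*} [CommGroup H] {g : ℕ} (y : Fin g × Bool → H) :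
    surfaceWord y = 1 :=
  surfaceWord_eq_one fun i => by rw [mul_comm (y (i, true))]; simp

namespace SurfaceGroup

variable {g : ℕ}

/-- The standard generators of the surface group. -/
def gen (x : Fin g × Bool) : SurfaceGroup g :=
  PresentedGroup.of (rels := {surfaceRel g}) x

/-- The canonical projection from the free group. -/
def proj : FreeGroup (Fin g × Bool) →* SurfaceGroup g :=
  PresentedGroup.mk {surfaceRel g}

theorem proj_of (x : Fin g × Bool) : proj (FreeGroup.of x) = gen x := rfl

theorem proj_surjective : Function.Surjective (proj (g := g)) :=
  PresentedGroup.mk_surjective _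

theorem surfaceWord_gen : surfaceWord (gen (g := g)) = 1 := by
  have h : proj (surfaceRel g) = 1 :=
    (QuotientGroup.eq_one_iff _).2 (Subgroup.subset_normalClosure rfl)
  rw [← h]
  exact (map_surfaceWord proj FreeGroup.of).symm

/-- The universal property of the surface group. -/
def lift {H : Type*} [Group H] (y : Fin g × Bool → H) (h : surfaceWord y = 1) :
    SurfaceGroup g →* H :=
  PresentedGroup.toGroup (rels := {surfaceRel g}) (f := y) (by
    rintro r rfl
    have := map_surfaceWord (FreeGroup.lift y) FreeGroup.of
    simp only [FreeGroup.lift_apply_of] at this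
    exact this.trans h)

theorem lift_gen {H : Type*} [Group H] (y : Fin g × Bool → H) (h : surfaceWord y = 1)
    (x : Fin g × Bool) : lift y h (gen x) = y x :=
  PresentedGroup.toGroup.of _

theorem closure_gen : Subgroup.closure (Set.range (gen (g := g))) = ⊤ :=
  PresentedGroup.closure_range_of _

theorem mem_of_gen_mem {K : Subgroup (SurfaceGroup g)} (h : ∀ x, gen x ∈ K)
    (t : SurfaceGroup g) : t ∈ K := by
  have : Subgroup.closure (Set.range (gen (g := g))) ≤ K :=
    (Subgroup.closure_le _).2 (by rintro _ ⟨x, rfl⟩; exact h x)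
  exact this (closure_gen ▸ Subgroup.mem_top t)

end SurfaceGroup

section PrimePowerIndex

variable {p : ℕ} {T : Type*} [Group T]

theorem exists_index_ker_eq_prime_pow [Fact p.Prime] {P : Type*} [Group P] [Finite P]
    (hP : IsPGroup p P) (f : T →* P) : ∃ k : ℕ, f.ker.index = p ^ k := by
  rw [Subgroup.index_ker]
  exact IsPGroup.iff_card.1 (hP.to_subgroup f.range)

theorem isPGroup_quotient_of_index {N : Subgroup T} [N.Normal]
    (h : ∃ k : ℕ, N.index = p ^ k) : IsPGroup p (T ⧸ N) := by
  obtain ⟨k, hk⟩ := h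
  exact IsPGroup.of_card (n := k) hk

theorem finite_quotient_of_index [Fact p.Prime] {N : Subgroup T}
    (h : ∃ k : ℕ, N.index = p ^ k) : Finite (T ⧸ N) := by
  obtain ⟨k, hk⟩ := h
  refine (Nat.finite_of_card_ne_zero (α := T ⧸ N) ?_)
  change N.index ≠ 0
  rw [hk]
  exact pow_ne_zero _ (Fact.out : p.Prime).ne_zero

theorem exists_index_inf_eq_prime_pow [Fact p.Prime] {N N' : Subgroup T} [N.Normal] [N'.Normal]
    (h : ∃ k : ℕ, N.index = p ^ k) (h' : ∃ k : ℕ, N'.index = p ^ k) :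
    ∃ k : ℕ, (N ⊓ N').index = p ^ k := by
  have := finite_quotient_of_index h
  have := finite_quotient_of_index h'
  have hP : IsPGroup p ((T ⧸ N) × (T ⧸ N')) := by
    obtain ⟨k, hk⟩ := h
    obtain ⟨k', hk'⟩ := h'
    refine IsPGroup.of_card (n := k + k') ?_
    rw [Nat.card_prod, pow_add, ← hk, ← hk']
    rfl
  have := exists_index_ker_eq_prime_pow hP
    ((QuotientGroup.mk' N).prod (QuotientGroup.mk' N'))
  rwa [MonoidHom.ker_prod, QuotientGroup.ker_mk', QuotientGroup.ker_mk'] at this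

end PrimePowerIndex

/-- A derivation (crossed homomorphism) `d : T → M`, where `T` acts on the `R`-module `M`
through `u : T →* R`. -/
def IsDeriv {T R M : Type*} [Group T] [Ring R] [AddCommGroup M] [Module R M]
    (u : T →* R) (d : T → M) : Prop :=
  ∀ x y, d (x * y) = d x + u x • d y

namespace IsDeriv

variable {T R M : Type*} [Group T] [Ring R] [AddCommGroup M] [Module R M]
  {u : T →* R} {d : T → M}

theorem map_one (h : IsDeriv u d) : d 1 = 0 := by
  have := h 1 1
  simpa using this

theorem smul_map_inv (h : IsDeriv u d) (x : T) : u x • d x⁻¹ = -d x := by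
  have := h x x⁻¹
  rw [mul_inv_cancel, h.map_one] at this
  exact eq_neg_of_add_eq_zero_right this.symm

theorem map_inv (h : IsDeriv u d) (x : T) : d x⁻¹ = -(u x⁻¹ • d x) := by
  have := h x⁻¹ x
  rw [inv_mul_cancel, h.map_one] at this
  exact eq_neg_of_add_eq_zero_left this.symm

theorem map_conj (h : IsDeriv u d) (x : T) {n : T} (hn : u n = 1) :
    d (x * n * x⁻¹) = u x • d n := by
  rw [h, h, map_mul, hn, mul_one, h.smul_map_inv]
  abel

theorem map_mul_of_left (h : IsDeriv u d) {n : T} (hn : u n = 1) (y : T) :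
    d (n * y) = d n + d y := by
  rw [h, hn, one_smul]

theorem map_pow (h : IsDeriv u d) (x : T) (k : ℕ) :
    d (x ^ k) = ∑ i ∈ Finset.range k, u x ^ i • d x := by
  induction k with
  | zero => simp [h.map_one]
  | succ k ih => rw [pow_succ, h, ih, Finset.sum_range_succ, _root_.map_pow]

theorem map_pow_of_eq_one (h : IsDeriv u d) {n : T} (hn : u n = 1) (k : ℕ) :
    d (n ^ k) = k • d n := by
  simp [h.map_pow, hn]

theorem add {d' : T → M} (h : IsDeriv u d) (h' : IsDeriv u d') :
    IsDeriv u (fun x => d x + d' x) := fun x y => by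
  simp only [h x y, h' x y, smul_add]
  abel

theorem map {R' M' : Type*} [Ring R'] [AddCommGroup M'] [Module R' M'] {u' : T →* R'}
    (h : IsDeriv u d) (θ : M →+ M') (hθ : ∀ t m, θ (u t • m) = u' t • θ m) :
    IsDeriv u' (fun x => θ (d x)) := fun x y => by
  simp only [h x y, map_add, hθ]

theorem comp {M' : Type*} [AddCommGroup M'] [Module R M'] (h : IsDeriv u d) (θ : M →ₗ[R] M') :
    IsDeriv u (fun x => θ (d x)) :=
  h.map θ.toAddMonoidHom fun t m => θ.map_smul (u t) m

/-- The elements on which `u` is trivial and whose derivative lies in a submodule. -/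
theorem exists_subgroup (h : IsDeriv u d) {N : Subgroup T} [N.Normal]
    (hN : ∀ n ∈ N, u n = 1) (L : Submodule R M) :
    ∃ K : Subgroup T, K.Normal ∧ ∀ x, x ∈ K ↔ x ∈ N ∧ d x ∈ L := by
  refine ⟨{ carrier := {x | x ∈ N ∧ d x ∈ L}, mul_mem' := ?_, one_mem' := ?_, inv_mem' := ?_ },
    ⟨?_⟩, fun x => Iff.rfl⟩
  · rintro x y ⟨hx, hx'⟩ ⟨hy, hy'⟩
    refine ⟨N.mul_mem hx hy, ?_⟩
    rw [h]
    exact L.add_mem hx' (L.smul_mem _ hy')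
  · exact ⟨N.one_mem, by rw [h.map_one]; exact L.zero_mem⟩
  · rintro x ⟨hx, hx'⟩
    refine ⟨N.inv_mem hx, ?_⟩
    rw [h.map_inv]
    exact L.neg_mem (L.smul_mem _ hx')
  · rintro n ⟨hn, hn'⟩ t
    refine ⟨Subgroup.Normal.conj_mem ‹_› n hn t, ?_⟩
    rw [h.map_conj t (hN n hn)]
    exact L.smul_mem _ hn'

end IsDeriv

section Free

variable {g : ℕ} {R M : Type*} [Ring R] [AddCommGroup M] [Module R M]

/-- The affine permutation `m ↦ c + u t • m`. -/
def affinePerm {T : Type*} [Group T] (u : T →* R) (t : T) (c : M) : Equiv.Perm M where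
  toFun m := c + u t • m
  invFun m := u t⁻¹ • (m - c)
  left_inv m := by simp [smul_smul, ← map_mul]
  right_inv m := by simp [smul_smul, ← map_mul]

/-- The derivation on the free group (acting through the surface group) with prescribed values on
the generators. -/
def freeDeriv (u : SurfaceGroup g →* R) (α : Fin g × Bool → M)
    (t : FreeGroup (Fin g × Bool)) : M :=
  FreeGroup.lift (fun x => affinePerm u (SurfaceGroup.gen x) (α x)) t 0

theorem lift_affinePerm (u : SurfaceGroup g →* R) (α : Fin g × Bool → M)
    (t : FreeGroup (Fin g × Bool)) (m : M) :
    FreeGroup.lift (fun x => affinePerm u (SurfaceGroup.gen x) (α x)) t m =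
      freeDeriv u α t + u (SurfaceGroup.proj t) • m := by
  unfold freeDeriv
  induction t using FreeGroup.induction_on generalizing m with
  | C1 => simp
  | of x => simp [affinePerm, SurfaceGroup.proj_of]
  | inv_of x _ =>
    simp [affinePerm, SurfaceGroup.proj_of, Equiv.Perm.inv_def, Equiv.symm, smul_sub]
    abel
  | mul x y hx hy =>
    rw [map_mul, Equiv.Perm.mul_apply, Equiv.Perm.mul_apply, hy m, hx (_ + _)]
    conv_rhs => rw [hx]
    rw [map_mul, map_mul, smul_add, mul_smul, add_assoc]

theorem freeDeriv_of (u : SurfaceGroup g →* R) (α : Fin g × Bool → M) (x : Fin g × Bool) :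
    freeDeriv u α (FreeGroup.of x) = α x := by
  simp [freeDeriv, affinePerm]

theorem isDeriv_freeDeriv (u : SurfaceGroup g →* R) (α : Fin g × Bool → M) :
    IsDeriv (u.comp SurfaceGroup.proj) (freeDeriv u α) := fun x y => by
  rw [freeDeriv, map_mul, Equiv.Perm.mul_apply, lift_affinePerm]
  rfl

/-- A derivation of the free group killing the surface relator descends to the surface group. -/
theorem exists_isDeriv (u : SurfaceGroup g →* R) (α : Fin g × Bool → M)
    (h : freeDeriv u α (surfaceRel g) = 0) :
    ∃ d : SurfaceGroup g → M, IsDeriv u d ∧ ∀ x, d (SurfaceGroup.gen x) = α x := by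
  set y := fun x : Fin g × Bool => affinePerm u (SurfaceGroup.gen x) (α x) with hy
  have hrel : SurfaceGroup.proj (surfaceRel g) = 1 :=
    (map_surfaceWord SurfaceGroup.proj FreeGroup.of).trans SurfaceGroup.surfaceWord_gen
  have hw : surfaceWord y = 1 := by
    have := map_surfaceWord (FreeGroup.lift y) FreeGroup.of
    simp only [FreeGroup.lift_apply_of] at this
    rw [← this]
    ext m
    have := lift_affinePerm u α (surfaceRel g) m
    rw [h, hrel, map_one, one_smul, zero_add] at this
    exact this
  have key : ∀ t : FreeGroup (Fin g × Bool),
      SurfaceGroup.lift y hw (SurfaceGroup.proj t) = FreeGroup.lift y t := by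
    intro t
    have : (SurfaceGroup.lift y hw).comp SurfaceGroup.proj = FreeGroup.lift y := by
      ext x : 1
      rw [MonoidHom.comp_apply, SurfaceGroup.proj_of, SurfaceGroup.lift_gen,
        FreeGroup.lift_apply_of]
    exact DFunLike.congr_fun this t
  refine ⟨fun t => SurfaceGroup.lift y hw t 0, fun s t => ?_, fun x => ?_⟩
  · obtain ⟨s, rfl⟩ := SurfaceGroup.proj_surjective s
    obtain ⟨t, rfl⟩ := SurfaceGroup.proj_surjective t
    simp only [← map_mul, key]
    exact isDeriv_freeDeriv u α s t
  · simp only [SurfaceGroup.lift_gen]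
    simp [hy, affinePerm]

/-- A derivation of the free group killing all the commutators `[aᵢ, bᵢ]` descends to the
surface group. -/
theorem exists_isDeriv_of_commutator (u : SurfaceGroup g →* R) (α : Fin g × Bool → M)
    (h : ∀ i, freeDeriv u α (FreeGroup.of (i, true) * FreeGroup.of (i, false) *
      (FreeGroup.of (i, true))⁻¹ * (FreeGroup.of (i, false))⁻¹) = 0) :
    ∃ d : SurfaceGroup g → M, IsDeriv u d ∧ ∀ x, d (SurfaceGroup.gen x) = α x := by
  have hd := isDeriv_freeDeriv u α
  let K : Submonoid (FreeGroup (Fin g × Bool)) :=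
    { carrier := {t | freeDeriv u α t = 0}
      one_mem' := hd.map_one
      mul_mem' := fun {x y} hx hy => by
        simp only [Set.mem_ofPred_eq] at hx hy ⊢
        rw [hd, hx, hy, smul_zero, add_zero] }
  exact exists_isDeriv u α (surfaceWord_mem (K := K) h)

/-- The value of a free derivation depends linearly on its values on the generators. -/
def freeDerivLinear (k : Type*) [CommRing k] [Module k M] [SMulCommClass k R M]
    (u : SurfaceGroup g →* R) (t : FreeGroup (Fin g × Bool)) :
    (Fin g × Bool → M) →ₗ[k] M where
  toFun α := freeDeriv u α t
  map_add' α β := by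
    induction t using FreeGroup.induction_on with
    | C1 => simp [(isDeriv_freeDeriv u _).map_one]
    | of x => simp [freeDeriv_of]
    | inv_of x h =>
      simp only [(isDeriv_freeDeriv u _).map_inv, h, smul_add]
      abel
    | mul x y hx hy =>
      simp only [isDeriv_freeDeriv u _ x y, hx, hy, smul_add]
      abel
  map_smul' c α := by
    simp only [RingHom.id_apply]
    induction t using FreeGroup.induction_on with
    | C1 => simp [(isDeriv_freeDeriv u _).map_one]
    | of x => simp [freeDeriv_of]
    | inv_of x h =>
      simp only [(isDeriv_freeDeriv u _).map_inv, h, smul_neg, smul_comm c]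
    | mul x y hx hy =>
      simp only [isDeriv_freeDeriv u _ x y, hx, hy, smul_add, smul_comm c]

end Free

section RationalSpan

variable {T : Type*} [Group T] {N : Subgroup T} [N.Normal]

/-- The action of `T` on the group ring of a quotient. -/
noncomputable def quotientAction (k : Type*) [CommRing k] (N : Subgroup T) [N.Normal] :
    T →* MonoidAlgebra k (T ⧸ N) :=
  (MonoidAlgebra.of k (T ⧸ N)).comp (QuotientGroup.mk' N)

theorem quotientAction_apply (k : Type*) [CommRing k] (t : T) :
    quotientAction k N t = MonoidAlgebra.single (t : T ⧸ N) 1 := rfl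

theorem quotientAction_eq_one (k : Type*) [CommRing k] {n : T} (hn : n ∈ N) :
    quotientAction k N n = 1 := by
  rw [quotientAction_apply, (QuotientGroup.eq_one_iff n).2 hn]
  rfl

/-- A rational derivation vanishing on a normal subgroup of finite index that acts trivially is
principal. -/
theorem IsDeriv.exists_eq_sub [Finite (T ⧸ N)] {R W : Type*} [Ring R] [AddCommGroup W]
    [Module R W] [Module ℚ W] {u : T →* R} {f : T → W} (hf : IsDeriv u f)
    (h0 : ∀ n ∈ N, f n = 0) : ∃ w : W, ∀ t, f t = w - u t • w := by
  classical
  have := Fintype.ofFinite (T ⧸ N)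
  have hcoset : ∀ s t : T, (s : T ⧸ N) = t → f s = f t := by
    intro s t hst
    have hn : s⁻¹ * t ∈ N := QuotientGroup.eq.1 hst
    have := hf s (s⁻¹ * t)
    rw [h0 _ hn, smul_zero, add_zero, mul_inv_cancel_left] at this
    exact this.symm
  let F : T ⧸ N → W := fun c => f c.out
  have hF : ∀ t : T, F t = f t := fun t => hcoset _ _ (QuotientGroup.out_eq' _)
  set w₀ := ∑ c, F c with hw₀
  have hsum : ∀ t, w₀ = (Fintype.card (T ⧸ N) : ℚ) • f t + u t • w₀ := by
    intro t
    have h1 : ∀ c : T ⧸ N, F (t * c) = f t + u t • F c := by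
      intro c
      induction c using QuotientGroup.induction_on with
      | H s => rw [← QuotientGroup.mk_mul, hF, hF, hf]
    calc w₀ = ∑ c, F ((t : T ⧸ N) * c) :=
          (Equiv.sum_comp (Equiv.mulLeft (t : T ⧸ N)) F).symm
      _ = _ := by
        simp only [h1, Finset.sum_add_distrib, ← Finset.smul_sum, Finset.sum_const,
          Finset.card_univ, Nat.cast_smul_eq_nsmul, hw₀]
  have hc : (Fintype.card (T ⧸ N) : ℚ) ≠ 0 := Nat.cast_ne_zero.2 Fintype.card_ne_zero
  refine ⟨(Fintype.card (T ⧸ N) : ℚ)⁻¹ • w₀, fun t => ?_⟩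
  have h2 : u t • (Fintype.card (T ⧸ N) : ℚ)⁻¹ • w₀ =
      (Fintype.card (T ⧸ N) : ℚ)⁻¹ • u t • w₀ :=
    map_rat_smul (DistribSMul.toAddMonoidHom W (u t)) _ w₀
  rw [h2, ← smul_sub]
  nth_rw 1 [hsum t]
  rw [add_sub_cancel_right, smul_smul, inv_mul_cancel₀ hc, one_smul]

/-- If `D` has a derivative span of maximal dimension, every derivation into a complement of that
span is, on `N`, a linear function of `D`. -/
theorem exists_linearMap_of_maximal {T : Type*} [Group T] {N : Subgroup T}
    {R : Type*} [Ring R] [Algebra ℚ R]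
    {M : Type*} [AddCommGroup M] [Module R M] [Module ℚ M] [IsScalarTower ℚ R M]
    [FiniteDimensional ℚ M]
    {u : T →* R} {D : T → M} (hD : IsDeriv u D)
    (hmax : ∀ D₁ : T → M, IsDeriv u D₁ → Module.finrank ℚ (Submodule.span R (D₁ '' N)) ≤
      Module.finrank ℚ (Submodule.span R (D '' N)))
    {W : Submodule R M} (hW : IsCompl (Submodule.span R (D '' N)) W)
    {f : T → W} (hf : IsDeriv u f) :
    ∃ θ : M →ₗ[R] W, ∀ n ∈ N, θ (D n) = f n := by
  set S := Submodule.span R (D '' N) with hS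
  have hfin : ∀ V : Submodule R M, FiniteDimensional ℚ V := fun V =>
    FiniteDimensional.of_injective (V.subtype.restrictScalars ℚ) V.injective_subtype
  let P : M →ₗ[R] S := S.projectionOnto W hW
  let D₁ : T → M := fun x => S.subtype (P (D x)) + W.subtype (f x)
  have hD' : IsDeriv u D₁ := ((hD.comp P).comp S.subtype).add (hf.comp W.subtype)
  have hPD : ∀ n (hn : n ∈ N), P (D n) = ⟨D n, Submodule.subset_span ⟨n, hn, rfl⟩⟩ := fun n hn =>
    Submodule.projectionOnto_apply_left hW ⟨D n, _⟩
  have hPD' : ∀ n ∈ N, P (D₁ n) = P (D n) := fun n hn => by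
    have h1 : P (S.subtype (P (D n))) = P (D n) := Submodule.projectionOnto_apply_left hW _
    have h2 : P (W.subtype (f n)) = 0 := Submodule.projectionOnto_apply_right hW _
    simp only [D₁, map_add]
    rw [h1, h2, add_zero]
  set S' := Submodule.span R (D₁ '' N) with hS'
  let q : S' →ₗ[R] S := P.domRestrict S'
  have hq : Function.Surjective q := by
    rintro ⟨v, hv⟩
    suffices hv' : ∃ w ∈ S', (P w : M) = v from
      hv'.elim fun w hw => ⟨⟨w, hw.1⟩, Subtype.ext hw.2⟩
    induction hv using Submodule.span_induction with
    | mem x hx =>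
      obtain ⟨n, hn, rfl⟩ := hx
      exact ⟨D₁ n, Submodule.subset_span ⟨n, hn, rfl⟩, by rw [hPD' n hn, hPD n hn]⟩
    | zero => exact ⟨0, S'.zero_mem, by simp⟩
    | add x y _ _ hx hy =>
      obtain ⟨a, ha, rfl⟩ := hx
      obtain ⟨b, hb, rfl⟩ := hy
      exact ⟨a + b, S'.add_mem ha hb, by simp⟩
    | smul r x _ hx =>
      obtain ⟨a, ha, rfl⟩ := hx
      exact ⟨r • a, S'.smul_mem r ha, by simp⟩
  have := hfin S
  have := hfin S'
  have hinj : Function.Injective q := by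
    have h1 : Function.Surjective (q.restrictScalars ℚ) := hq
    have h2 : Module.finrank ℚ S' = Module.finrank ℚ S :=
      le_antisymm (hmax D₁ hD') (LinearMap.finrank_le_finrank_of_surjective h1)
    exact (LinearMap.injective_iff_surjective_of_finrank_eq_finrank h2
      (f := q.restrictScalars ℚ)).2 h1
  let e := LinearEquiv.ofBijective q ⟨hinj, hq⟩
  let Q : M →ₗ[R] W := W.projectionOnto S hW.symm
  refine ⟨Q ∘ₗ S'.subtype ∘ₗ e.symm.toLinearMap ∘ₗ P, fun n hn => ?_⟩
  have h1 : e.symm (P (D n)) = ⟨D₁ n, Submodule.subset_span ⟨n, hn, rfl⟩⟩ := by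
    rw [LinearEquiv.symm_apply_eq]
    exact (hPD' n hn).symm
  have h2 : Q (D₁ n) = f n := by
    have h3 : Q (S.subtype (P (D n))) = 0 := Submodule.projectionOnto_apply_right hW.symm _
    have h4 : Q (W.subtype (f n)) = f n := Submodule.projectionOnto_apply_left hW.symm _
    simp only [D₁, map_add]
    rw [h3, h4, zero_add]
  simp only [LinearMap.comp_apply, LinearEquiv.coe_coe, h1]
  exact h2

end RationalSpan

/-- For a surface group of genus at least two, some derivation into the square of the rational
group ring of a finite quotient `T ⧸ N` has the property that its values on `N` span. -/
theorem exists_isDeriv_span_eq_top {g : ℕ} (hg : 2 ≤ g) (N : Subgroup (SurfaceGroup g))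
    [N.Normal] [Finite (SurfaceGroup g ⧸ N)] :
    ∃ D : SurfaceGroup g → MonoidAlgebra ℚ (SurfaceGroup g ⧸ N) ×
        MonoidAlgebra ℚ (SurfaceGroup g ⧸ N),
      IsDeriv (quotientAction ℚ N) D ∧
        Submodule.span (MonoidAlgebra ℚ (SurfaceGroup g ⧸ N)) (D '' N) = ⊤ := by
  classical
  set R := MonoidAlgebra ℚ (SurfaceGroup g ⧸ N) with hR
  set u : SurfaceGroup g →* R := quotientAction ℚ N with hu
  have hfinR : FiniteDimensional ℚ R := inferInstance
  obtain ⟨D, hD, hmax⟩ : ∃ D : SurfaceGroup g → R × R, IsDeriv u D ∧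
      ∀ D₁ : SurfaceGroup g → R × R, IsDeriv u D₁ →
        Module.finrank ℚ (Submodule.span R (D₁ '' N)) ≤
        Module.finrank ℚ (Submodule.span R (D '' N)) := by
    let A : Set ℕ := {m | ∃ D : SurfaceGroup g → R × R, IsDeriv u D ∧
      Module.finrank ℚ (Submodule.span R (D '' N)) = m}
    have hA : A.Nonempty := ⟨_, fun _ => 0, fun x y => by simp, rfl⟩
    have hA' : BddAbove A := by
      refine ⟨Module.finrank ℚ (R × R), ?_⟩
      rintro _ ⟨D, -, rfl⟩
      exact LinearMap.finrank_le_finrank_of_injective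
        (f := (Submodule.span R (D '' N)).subtype.restrictScalars ℚ)
        (Submodule.injective_subtype _)
    obtain ⟨D, hD, hDm⟩ := Nat.sSup_mem hA hA'
    exact ⟨D, hD, fun D₁ hD' => hDm ▸ le_csSup hA' ⟨D₁, hD', rfl⟩⟩
  refine ⟨D, hD, ?_⟩
  by_contra hS
  set S := Submodule.span R (D '' N) with hSdef
  obtain ⟨W, hW⟩ := MonoidAlgebra.Submodule.exists_isCompl S
  have hfinW : FiniteDimensional ℚ W :=
    FiniteDimensional.of_injective (W.subtype.restrictScalars ℚ) W.injective_subtype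
  let Φ := freeDerivLinear (M := W) ℚ u (surfaceRel g)
  let Ψ : (W × W) × W →ₗ[ℚ] (Fin g × Bool → W) :=
    { toFun := fun w x => (D (SurfaceGroup.gen x)).1 • w.1.1 + (D (SurfaceGroup.gen x)).2 • w.1.2 +
        (w.2 - u (SurfaceGroup.gen x) • w.2)
      map_add' := fun v w => by
        ext1 x
        simp only [Prod.fst_add, Prod.snd_add, smul_add, Pi.add_apply]
        abel
      map_smul' := fun c w => by
        ext1 x
        simp only [Prod.smul_fst, Prod.smul_snd, Pi.smul_apply, RingHom.id_apply, smul_add,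
          smul_sub, smul_comm c] }
  have hθ : ∀ (θ : R × R →ₗ[R] W) (v : R × R), θ v = v.1 • θ (1, 0) + v.2 • θ (0, 1) := by
    intro θ v
    rw [← map_smul, ← map_smul, ← map_add]
    simp
  have hrange : LinearMap.ker Φ ≤ LinearMap.range Ψ := by
    intro α hα
    obtain ⟨f, hf, hfα⟩ := exists_isDeriv u α hα
    obtain ⟨θ, hθf⟩ := exists_linearMap_of_maximal hD hmax hW hf
    obtain ⟨w, hw⟩ := (hf.add ((hD.comp θ).comp (-LinearMap.id))).exists_eq_sub (N := N)
      fun n hn => by simp [hθf n hn]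
    refine ⟨((θ (1, 0), θ (0, 1)), w), ?_⟩
    ext1 x
    have := hw (SurfaceGroup.gen x)
    simp only [LinearMap.neg_apply, LinearMap.id_apply, hfα] at this
    simp only [Ψ, LinearMap.coe_mk, AddHom.coe_mk, ← hθ, ← this]
    abel
  have hker : LinearMap.ker Ψ ≠ ⊥ := by
    intro hbot
    let Q : R × R →ₗ[R] W := W.projectionOnto S hW.symm
    obtain ⟨w, hw⟩ := (hD.comp Q).exists_eq_sub (N := N) fun n hn =>
      Submodule.projectionOnto_apply_right hW.symm
        ⟨D n, Submodule.subset_span ⟨n, hn, rfl⟩⟩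
    have hmem : ((Q (1, 0), Q (0, 1)), -w) ∈ LinearMap.ker Ψ := by
      rw [LinearMap.mem_ker]
      ext1 x
      simp only [Ψ, LinearMap.coe_mk, AddHom.coe_mk, ← hθ, hw, smul_neg, Pi.zero_apply]
      abel
    rw [hbot, Submodule.mem_bot, Prod.mk_eq_zero, Prod.mk_eq_zero] at hmem
    have hQ : ∀ v, Q v = 0 := fun v => by rw [hθ, hmem.1.1, hmem.1.2, smul_zero, smul_zero, add_zero]
    have hWbot : W = ⊥ := by
      rw [eq_bot_iff]
      intro v hv
      have h1 : Q v = ⟨v, hv⟩ := Submodule.projectionOnto_apply_left hW.symm ⟨v, hv⟩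
      rw [hQ] at h1
      exact (congrArg Subtype.val h1).symm
    exact hS (by simpa [hWbot] using hW.sup_eq_top)
  have h1 := Submodule.finrank_mono hrange
  have h2 := LinearMap.finrank_range_add_finrank_ker Φ
  have h3 := LinearMap.finrank_range_add_finrank_ker Ψ
  have h4 : Module.finrank ℚ (LinearMap.range Φ) ≤ Module.finrank ℚ W := Submodule.finrank_le _
  have h5 : 0 < Module.finrank ℚ (LinearMap.ker Ψ) :=
    Nat.pos_of_ne_zero fun h => hker (Submodule.finrank_eq_zero.1 h)
  rw [Module.finrank_pi_fintype] at h2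
  simp only [Module.finrank_prod, Finset.sum_const, Finset.card_univ, Fintype.card_prod,
    Fintype.card_fin, Fintype.card_bool, smul_eq_mul] at h2 h3
  nlinarith [Nat.mul_le_mul_right (Module.finrank ℚ W) hg]

section ClearDenominators

variable {T : Type*} [Group T] {N : Subgroup T} [N.Normal]

theorem mapRingHom_quotientAction {k l : Type*} [CommRing k] [CommRing l] (f : k →+* l) (t : T) :
    MonoidAlgebra.mapRingHom (T ⧸ N) f (quotientAction k N t) = quotientAction l N t := by
  simp [quotientAction_apply]

theorem exists_nsmul_mem_range_mapRingHom {G : Type*} [Group G] (v : MonoidAlgebra ℚ G) :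
    ∃ c : ℕ, 0 < c ∧ ∃ w, MonoidAlgebra.mapRingHom G (Int.castRingHom ℚ) w = c • v := by
  induction v using MonoidAlgebra.induction_linear with
  | zero => exact ⟨1, one_pos, 0, by simp⟩
  | add v v' hv hv' =>
    obtain ⟨c, hc, w, hw⟩ := hv
    obtain ⟨c', hc', w', hw'⟩ := hv'
    refine ⟨c * c', by positivity, c' • w + c • w', ?_⟩
    rw [map_add, map_nsmul, map_nsmul, hw, hw', smul_add, smul_smul, smul_smul, mul_comm c' c]
  | single x q =>
    refine ⟨q.den, q.den_pos, MonoidAlgebra.single x q.num, ?_⟩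
    rw [MonoidAlgebra.mapRingHom_single, MonoidAlgebra.smul_single]
    congr 1
    simp [nsmul_eq_mul, Rat.den_mul_eq_num]

theorem IsDeriv.exists_map_eq_zsmul {T : Type*} [Group T] {N : Subgroup T}
    {R M : Type*} [Ring R] [AddCommGroup M] [Module R M]
    {u : T →* R} {D : T → M} (hD : IsDeriv u D) (hu : ∀ n ∈ N, u n = 1) {n : T} (hn : n ∈ N)
    (z : ℤ) : ∃ n' ∈ N, D n' = z • D n := by
  obtain ⟨k, rfl | rfl⟩ := z.eq_nat_or_neg
  · exact ⟨n ^ k, N.pow_mem hn k, by rw [hD.map_pow_of_eq_one (hu n hn), natCast_zsmul]⟩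
  · refine ⟨(n⁻¹) ^ k, N.pow_mem (N.inv_mem hn) k, ?_⟩
    rw [hD.map_pow_of_eq_one (hu _ (N.inv_mem hn)), hD.map_inv, hu _ (N.inv_mem hn), one_smul,
      neg_smul, natCast_zsmul, smul_neg]

/-- Every vector in the span of the values of `D` on `N` has a multiple that is such a value. -/
theorem IsDeriv.exists_eq_nsmul_of_mem_span {M : Type*} [AddCommGroup M]
    [Module (MonoidAlgebra ℚ (T ⧸ N)) M] {D : T → M}
    (hD : IsDeriv (quotientAction ℚ N) D) {v : M}
    (hv : v ∈ Submodule.span (MonoidAlgebra ℚ (T ⧸ N)) (D '' N)) :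
    ∃ m : ℕ, 0 < m ∧ ∃ n ∈ N, D n = m • v := by
  have hu : ∀ n ∈ N, quotientAction ℚ N n = 1 := fun n hn => quotientAction_eq_one ℚ hn
  have hadd : ∀ v w : M, (∃ m : ℕ, 0 < m ∧ ∃ n ∈ N, D n = m • v) →
      (∃ m : ℕ, 0 < m ∧ ∃ n ∈ N, D n = m • w) → ∃ m : ℕ, 0 < m ∧ ∃ n ∈ N, D n = m • (v + w) := by
    rintro v w ⟨m, hm, n, hn, h⟩ ⟨m', hm', n', hn', h'⟩
    refine ⟨m * m', by positivity, n ^ m' * n' ^ m, N.mul_mem (N.pow_mem hn _) (N.pow_mem hn' _), ?_⟩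
    rw [hD.map_mul_of_left (hu _ (N.pow_mem hn _)), hD.map_pow_of_eq_one (hu n hn),
      hD.map_pow_of_eq_one (hu n' hn'), h, h', smul_add, smul_smul, smul_smul, mul_comm m' m]
  induction hv using Submodule.span_induction with
  | mem x hx =>
    obtain ⟨n, hn, rfl⟩ := hx
    exact ⟨1, one_pos, n, hn, (one_smul _ _).symm⟩
  | zero => exact ⟨1, one_pos, 1, N.one_mem, by simp [hD.map_one]⟩
  | add x y _ _ hx hy => exact hadd x y hx hy
  | smul r x _ hx =>
    induction r using MonoidAlgebra.induction_linear with
    | zero => exact ⟨1, one_pos, 1, N.one_mem, by simp [hD.map_one]⟩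
    | add r s hr hs =>
      rw [add_smul]
      exact hadd _ _ hr hs
    | single c q =>
      induction c using QuotientGroup.induction_on with
      | H t =>
        obtain ⟨m, hm, n, hn, h⟩ := hx
        have hn' : t * n * t⁻¹ ∈ N := Subgroup.Normal.conj_mem ‹_› n hn t
        obtain ⟨n', hn'', h'⟩ := hD.exists_map_eq_zsmul hu hn' q.num
        refine ⟨m * q.den, Nat.mul_pos hm q.den_pos, n', hn'', ?_⟩
        rw [h', hD.map_conj t (hu n hn), h, quotientAction_apply, ← Nat.cast_smul_eq_nsmul
          (MonoidAlgebra ℚ (T ⧸ N)), ← Nat.cast_smul_eq_nsmul (MonoidAlgebra ℚ (T ⧸ N)),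
          ← Int.cast_smul_eq_zsmul (MonoidAlgebra ℚ (T ⧸ N)), smul_smul, smul_smul, smul_smul]
        congr 1
        simp only [MonoidAlgebra.natCast_def, MonoidAlgebra.intCast_def,
          MonoidAlgebra.single_mul_single, one_mul, mul_one]
        congr 1
        push_cast
        rw [mul_assoc, Rat.den_mul_eq_num]
        ring

end ClearDenominators

/-- An integral version of `exists_isDeriv_span_eq_top`. -/
theorem exists_isDeriv_int {g : ℕ} (hg : 2 ≤ g) (N : Subgroup (SurfaceGroup g))
    [N.Normal] [Finite (SurfaceGroup g ⧸ N)] :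
    ∃ D : SurfaceGroup g → MonoidAlgebra ℤ (SurfaceGroup g ⧸ N) ×
        MonoidAlgebra ℤ (SurfaceGroup g ⧸ N),
      IsDeriv (quotientAction ℤ N) D ∧ ∃ m : ℕ, 0 < m ∧ ∃ n₁ ∈ N, ∃ n₂ ∈ N,
        D n₁ = ((m : MonoidAlgebra ℤ (SurfaceGroup g ⧸ N)), 0) ∧
        D n₂ = (0, (m : MonoidAlgebra ℤ (SurfaceGroup g ⧸ N))) := by
  classical
  obtain ⟨D, hD, hspan⟩ := exists_isDeriv_span_eq_top hg N
  have hu : ∀ n ∈ N, quotientAction ℚ N n = 1 := fun n hn => quotientAction_eq_one ℚ hn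
  set ρ := MonoidAlgebra.mapRingHom (SurfaceGroup g ⧸ N) (Int.castRingHom ℚ) with hρ
  have hρinj : Function.Injective ρ := by
    intro x y hxy
    ext c
    have := congrArg (fun z => z.coeff c) hxy
    simpa [hρ] using this
  choose e he E hE using fun v : MonoidAlgebra ℚ (SurfaceGroup g ⧸ N) =>
    exists_nsmul_mem_range_mapRingHom v
  let c : ℕ := ∏ x : Fin g × Bool, e (D (SurfaceGroup.gen x)).1 * e (D (SurfaceGroup.gen x)).2
  have hc : 0 < c := Finset.prod_pos fun x _ => Nat.mul_pos (he _) (he _)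
  let ι := ρ.toAddMonoidHom.prodMap ρ.toAddMonoidHom
  have hι : ∀ v w, ι (v, w) = (ρ v, ρ w) := fun _ _ => rfl
  have hιinj : Function.Injective ι := fun x y hxy =>
    Prod.ext (hρinj (congrArg Prod.fst hxy)) (hρinj (congrArg Prod.snd hxy))
  have hιsmul : ∀ (t : SurfaceGroup g) (v : MonoidAlgebra ℤ (SurfaceGroup g ⧸ N) × _),
      ι (quotientAction ℤ N t • v) = quotientAction ℚ N t • ι v := by
    rintro t ⟨v, w⟩
    simp only [Prod.smul_mk, smul_eq_mul, hι, map_mul, hρ, mapRingHom_quotientAction]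
  have hcD : IsDeriv (quotientAction ℚ N) (fun t => c • D t) :=
    hD.map (nsmulAddMonoidHom c) fun t m => smul_comm _ _ _
  let K : Subgroup (SurfaceGroup g) :=
    { carrier := {t | ∃ v, ι v = c • D t}
      one_mem' := ⟨0, by simp [hD.map_one]⟩
      mul_mem' := by
        rintro s t ⟨v, hv⟩ ⟨w, hw⟩
        refine ⟨v + quotientAction ℤ N s • w, ?_⟩
        rw [map_add, hιsmul, hv, hw]
        exact (hcD s t).symm
      inv_mem' := by
        rintro s ⟨v, hv⟩
        refine ⟨-(quotientAction ℤ N s⁻¹ • v), ?_⟩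
        rw [map_neg, hιsmul, hv]
        exact (hcD.map_inv s).symm }
  have hK : ∀ t, ∃ v, ι v = c • D t := by
    refine SurfaceGroup.mem_of_gen_mem (K := K) fun x => ?_
    obtain ⟨d, hd⟩ := Finset.dvd_prod_of_mem
      (fun x : Fin g × Bool => e (D (SurfaceGroup.gen x)).1 * e (D (SurfaceGroup.gen x)).2)
      (Finset.mem_univ x)
    refine ⟨((d * e (D (SurfaceGroup.gen x)).2) • E (D (SurfaceGroup.gen x)).1,
      (d * e (D (SurfaceGroup.gen x)).1) • E (D (SurfaceGroup.gen x)).2), ?_⟩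
    rw [hι, map_nsmul, map_nsmul, hE, hE]
    refine Prod.ext ?_ ?_
    · simp only [c, hd, smul_smul, Prod.smul_fst]
      congr 1
      ring
    · simp only [c, hd, smul_smul, Prod.smul_snd]
      congr 1
      ring
  choose D' hD' using hK
  obtain ⟨m₁, hm₁, n₁, hn₁, h₁⟩ := hD.exists_eq_nsmul_of_mem_span (v := (1, 0))
    (hspan ▸ Submodule.mem_top)
  obtain ⟨m₂, hm₂, n₂, hn₂, h₂⟩ := hD.exists_eq_nsmul_of_mem_span (v := (0, 1))
    (hspan ▸ Submodule.mem_top)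
  refine ⟨D', fun s t => hιinj ?_, c * m₁ * m₂, by positivity, n₁ ^ m₂, N.pow_mem hn₁ _,
    n₂ ^ m₁, N.pow_mem hn₂ _, hιinj ?_, hιinj ?_⟩
  · rw [map_add, hιsmul, hD', hD', hD']
    exact hcD s t
  · rw [hD', hD.map_pow_of_eq_one (hu n₁ hn₁), h₁, hι, map_natCast, map_zero]
    simp only [Prod.smul_mk, smul_zero, nsmul_eq_mul, mul_one, Prod.mk.injEq, and_true]
    rw [← Nat.cast_mul, ← Nat.cast_mul]
    congr 1
    ring
  · rw [hD', hD.map_pow_of_eq_one (hu n₂ hn₂), h₂, hι, map_natCast, map_zero]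
    simp only [Prod.smul_mk, smul_zero, nsmul_eq_mul, mul_one, Prod.mk.injEq, true_and]
    rw [← Nat.cast_mul, ← Nat.cast_mul]
    congr 1
    ring

section

variable {p : ℕ} [Fact p.Prime]

/-- A modular version of `exists_isDeriv_int`. -/
theorem exists_isDeriv_zmod {g : ℕ} (hg : 2 ≤ g) (N : Subgroup (SurfaceGroup g))
    [N.Normal] [Finite (SurfaceGroup g ⧸ N)] :
    ∃ (j : ℕ) (d : SurfaceGroup g → MonoidAlgebra (ZMod (p ^ (j + 1))) (SurfaceGroup g ⧸ N) ×
        MonoidAlgebra (ZMod (p ^ (j + 1))) (SurfaceGroup g ⧸ N)),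
      IsDeriv (quotientAction (ZMod (p ^ (j + 1))) N) d ∧ ∃ n₁ ∈ N, ∃ n₂ ∈ N,
        d n₁ = (((p ^ j : ℕ) : MonoidAlgebra (ZMod (p ^ (j + 1))) (SurfaceGroup g ⧸ N)), 0) ∧
        d n₂ = (0, ((p ^ j : ℕ) : MonoidAlgebra (ZMod (p ^ (j + 1))) (SurfaceGroup g ⧸ N))) := by
  have hp : p.Prime := Fact.out
  obtain ⟨D, hD, m, hm, n₁, hn₁, n₂, hn₂, h₁, h₂⟩ := exists_isDeriv_int hg N
  obtain ⟨j, m', hm', rfl⟩ := Nat.exists_eq_pow_mul_and_not_dvd hm.ne' p hp.ne_one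
  obtain ⟨r, -, hr⟩ : ∃ r < p ^ (j + 1), m' * r % p ^ (j + 1) = 1 :=
    Nat.exists_mul_mod_eq_one_of_coprime
      (Nat.Coprime.pow_right _ ((Nat.Prime.coprime_iff_not_dvd hp).2 hm').symm)
      (Nat.one_lt_pow (Nat.succ_ne_zero j) hp.one_lt)
  set E := MonoidAlgebra (ZMod (p ^ (j + 1))) (SurfaceGroup g ⧸ N) with hE
  have hr' : ((m' * r : ℕ) : E) = 1 := by
    have : ((m' * r : ℕ) : ZMod (p ^ (j + 1))) = (1 : ℕ) := by
      rw [ZMod.natCast_eq_natCast_iff']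
      rw [hr, Nat.mod_eq_of_lt (Nat.one_lt_pow (Nat.succ_ne_zero j) hp.one_lt)]
    rw [MonoidAlgebra.natCast_def, this, Nat.cast_one]
    rfl
  let ρ := MonoidAlgebra.mapRingHom (SurfaceGroup g ⧸ N) (Int.castRingHom (ZMod (p ^ (j + 1))))
  let ι := ρ.toAddMonoidHom.prodMap ρ.toAddMonoidHom
  have hι : ∀ v w, ι (v, w) = (ρ v, ρ w) := fun _ _ => rfl
  have hd : IsDeriv (quotientAction (ZMod (p ^ (j + 1))) N) (fun t => ι (D t)) :=
    hD.map ι fun t v => by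
      obtain ⟨v, w⟩ := v
      simp only [Prod.smul_mk, smul_eq_mul, hι, map_mul, ρ, mapRingHom_quotientAction]
  refine ⟨j, fun t => ι (D t), hd, n₁ ^ r, N.pow_mem hn₁ r, n₂ ^ r, N.pow_mem hn₂ r, ?_, ?_⟩
  · refine (hd.map_pow_of_eq_one (quotientAction_eq_one _ hn₁) r).trans ?_
    rw [h₁, hι, map_zero, map_natCast]
    simp only [Prod.smul_mk, smul_zero, nsmul_eq_mul, Prod.mk.injEq, and_true]
    rw [← Nat.cast_mul, show r * (p ^ j * m') = p ^ j * (m' * r) by ring, Nat.cast_mul, hr', mul_one]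
  · refine (hd.map_pow_of_eq_one (quotientAction_eq_one _ hn₂) r).trans ?_
    rw [h₂, hι, map_zero, map_natCast]
    simp only [Prod.smul_mk, smul_zero, nsmul_eq_mul, Prod.mk.injEq, true_and]
    rw [← Nat.cast_mul, show r * (p ^ j * m') = p ^ j * (m' * r) by ring, Nat.cast_mul, hr', mul_one]

theorem IsDeriv.exists_subgroup_index {T R M : Type*} [Group T] [Ring R] [AddCommGroup M]
    [Module R M] {u : T →* R} {d : T → M} (h : IsDeriv u d) {N : Subgroup T} [N.Normal]
    (hN : ∀ n ∈ N, u n = 1) (hNp : ∃ k : ℕ, N.index = p ^ k) [Finite M]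
    {s : ℕ} (hM : ∀ m : M, p ^ s • m = 0) (L : Submodule R M) :
    ∃ K : Subgroup T, K.Normal ∧ (∃ k : ℕ, K.index = p ^ k) ∧ ∀ x, x ∈ K ↔ x ∈ N ∧ d x ∈ L := by
  obtain ⟨K, hK, hKmem⟩ := h.exists_subgroup hN L
  refine ⟨K, hK, ?_, hKmem⟩
  have hKN : K ≤ N := fun x hx => ((hKmem x).1 hx).1
  let ψ : N →* Multiplicative (M ⧸ L) :=
    { toFun := fun n => Multiplicative.ofAdd (Submodule.Quotient.mk (d n))
      map_one' := by rw [Subgroup.coe_one, h.map_one]; rfl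
      map_mul' := fun a b => by
        rw [Subgroup.coe_mul, h.map_mul_of_left (hN a a.2)]
        rfl }
  have hψ : K.subgroupOf N = ψ.ker := by
    ext ⟨x, hx⟩
    rw [Subgroup.mem_subgroupOf, MonoidHom.mem_ker, hKmem]
    change _ ↔ Submodule.Quotient.mk (d x) = (0 : M ⧸ L)
    rw [Submodule.Quotient.mk_eq_zero]
    exact and_iff_right hx
  have hP : IsPGroup p (Multiplicative (M ⧸ L)) := fun x => by
    obtain ⟨m, hm⟩ := Submodule.Quotient.mk_surjective L (Multiplicative.toAdd x)
    refine ⟨s, ?_⟩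
    apply Multiplicative.toAdd.injective
    rw [toAdd_pow, ← hm, ← Submodule.Quotient.mk_smul, hM]
    rfl
  have : Finite (M ⧸ L) := Finite.of_surjective _ (Submodule.Quotient.mk_surjective L)
  obtain ⟨k, hk⟩ := exists_index_ker_eq_prime_pow hP ψ
  obtain ⟨l, hl⟩ := hNp
  refine ⟨k + l, ?_⟩
  rw [← Subgroup.relIndex_mul_index hKN, Subgroup.relIndex, hψ, hk, hl, pow_add]

theorem coeff_quotientAction_mul {T : Type*} [Group T] {N : Subgroup T} [N.Normal] (k : Type*)
    [CommRing k] (t : T) (v : MonoidAlgebra k (T ⧸ N)) (c : T ⧸ N) :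
    (quotientAction k N t * v).coeff c = v.coeff ((t : T ⧸ N)⁻¹ * c) := by
  rw [quotientAction_apply, MonoidAlgebra.coeff_single_mul_apply, one_mul]

theorem coeff_mul_quotientAction {T : Type*} [Group T] {N : Subgroup T} [N.Normal] (k : Type*)
    [CommRing k] (t : T) (v : MonoidAlgebra k (T ⧸ N)) (c : T ⧸ N) :
    (v * quotientAction k N t).coeff c = v.coeff (c * (t : T ⧸ N)⁻¹) := by
  rw [quotientAction_apply, MonoidAlgebra.coeff_mul_single_apply, mul_one]

/-- A function on a finite `p`-group `G` with values killed by `p`, invariant under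
`x ↦ ψ t * x * t⁻¹` and with nonzero sum, is nonzero somewhere that realises `ψ` as a
conjugation. -/
theorem exists_conj_of_sum_ne_zero {G A : Type*} [Group G] [Fintype G] (hG : IsPGroup p G)
    [AddCommGroup A] (ψ : G →* G) (l : G → A) (hpl : ∀ x, p • l x = 0)
    (hl : ∀ t x, l (ψ t * x * t⁻¹) = l x) (hsum : ∑ x, l x ≠ 0) :
    ∃ x, ∀ t, ψ t = x * t * x⁻¹ := by
  classical
  by_contra hcon
  apply hsum
  have h1 := Finset.sum_comp (s := (Finset.univ : Finset G)) (fun c : A => c) l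
  rw [h1]
  refine Finset.sum_eq_zero fun c hc => ?_
  obtain ⟨x₀, -, rfl⟩ := Finset.mem_image.1 hc
  let act : MulAction G {x : G // l x = l x₀} :=
    { smul := fun t x => ⟨ψ t * x * t⁻¹, (hl t x).trans x.2⟩
      one_smul := fun x => Subtype.ext (by change ψ 1 * x * 1⁻¹ = x; simp)
      mul_smul := fun s t x => Subtype.ext (by
        change ψ (s * t) * x * (s * t)⁻¹ = ψ s * (ψ t * x * t⁻¹) * s⁻¹
        simp [mul_assoc]) }
  have hdvd : p ∣ Nat.card {x : G // l x = l x₀} := by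
    by_contra hnd
    obtain ⟨x, hx⟩ := hG.nonempty_fixed_point_of_prime_not_dvd_card {x : G // l x = l x₀} hnd
    refine hcon ⟨x, fun t => ?_⟩
    have : ψ t * x * t⁻¹ = (x : G) := congrArg Subtype.val (hx t)
    exact eq_mul_inv_of_mul_eq (mul_inv_eq_iff_eq_mul.1 this)
  rw [Nat.card_eq_fintype_card, Fintype.card_subtype] at hdvd
  obtain ⟨r, hr⟩ := hdvd
  rw [hr, mul_comm, mul_smul, hpl, smul_zero]

/-- An endomorphism of the surface group preserving the normal subgroups of `p`-power index is
inner modulo each of them. -/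
theorem exists_eq_conj_mod {g : ℕ} (hg : 2 ≤ g) (φ : SurfaceGroup g →* SurfaceGroup g)
    (hφ : ∀ N : Subgroup (SurfaceGroup g), N.Normal → (∃ k : ℕ, N.index = p ^ k) →
      ∀ x, φ x ∈ N ↔ x ∈ N)
    (N : Subgroup (SurfaceGroup g)) [hNn : N.Normal] (hN : ∃ k : ℕ, N.index = p ^ k) :
    ∃ h : SurfaceGroup g, ∀ x,
      (φ x : SurfaceGroup g ⧸ N) = (h * x * h⁻¹ : SurfaceGroup g) := by
  classical
  have hfin := finite_quotient_of_index hN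
  have := Fintype.ofFinite (SurfaceGroup g ⧸ N)
  obtain ⟨j, d, hd, n₁, hn₁, n₂, hn₂, h₁, h₂⟩ := exists_isDeriv_zmod (p := p) hg N
  let E := MonoidAlgebra (ZMod (p ^ (j + 1))) (SurfaceGroup g ⧸ N)
  set u : SurfaceGroup g →* E := quotientAction (ZMod (p ^ (j + 1))) N with hu
  set z : E := ((p ^ j : ℕ) : E) with hz
  have hp : p.Prime := Fact.out
  have : NeZero (p ^ (j + 1)) := ⟨pow_ne_zero _ hp.ne_zero⟩
  have : Finite E := Finite.of_injective _ (MonoidAlgebra.coeff_injective.comp Function.injective_id)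
  have hu1 : ∀ n ∈ N, u n = 1 := fun n hn => quotientAction_eq_one _ hn
  have hpE : ∀ v : E, p ^ (j + 1) • v = 0 := fun v => by
    rw [← Nat.cast_smul_eq_nsmul (ZMod (p ^ (j + 1))), ZMod.natCast_self, zero_smul]
  have hpow : ∀ v : E × E, p ^ (j + 1) • v = 0 := fun v => Prod.ext (hpE _) (hpE _)
  have hφN : ∀ n ∈ N, φ n ∈ N := fun n hn => (hφ N hNn hN n).2 hn
  have hmem : ∀ (L : Submodule E (E × E)) (n : SurfaceGroup g), n ∈ N →
      (d (φ n) ∈ L ↔ d n ∈ L) := by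
    intro L n hn
    obtain ⟨K, hK, hKp, hKmem⟩ := hd.exists_subgroup_index hu1 hN hpow L
    have := hφ K hK hKp n
    rw [hKmem, hKmem] at this
    simpa [hn, hφN n hn] using this
  have hspan : ∀ n ∈ N, ∃ r : E, r • d n = d (φ n) := fun n hn =>
    Submodule.mem_span_singleton.1 ((hmem _ n hn).2 (Submodule.mem_span_singleton_self (d n)))
  have hcomm : ∀ v : E, v * z = z * v := fun v => (Nat.cast_commute (p ^ j) v).symm
  obtain ⟨r₁, hr₁⟩ := hspan n₁ hn₁
  obtain ⟨r₂, hr₂⟩ := hspan n₂ hn₂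
  have hd₁ : d (φ n₁) = (r₁ * z, 0) := by rw [← hr₁, h₁]; simp
  have hd₂ : d (φ n₂) = (0, r₂ * z) := by rw [← hr₂, h₂]; simp
  have htw : ∀ t, ∃ r : E, u (φ t) * (r₁ * z) = r * (u t * z) ∧ r₂ * z = r * z := by
    intro t
    have hn' : t * n₁ * t⁻¹ ∈ N := hNn.conj_mem _ hn₁ t
    obtain ⟨r, hr⟩ := hspan (t * n₁ * t⁻¹ * n₂) (N.mul_mem hn' hn₂)
    refine ⟨r, ?_⟩
    rw [hd.map_mul_of_left (hu1 _ hn'), hd.map_conj t (hu1 _ hn₁), map_mul,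
      hd.map_mul_of_left (hu1 _ (hφN _ hn')), map_mul, map_mul, map_inv,
      hd.map_conj (φ t) (hu1 _ (hφN _ hn₁)), h₁, h₂, hd₁, hd₂] at hr
    have hr₁' := congrArg Prod.fst hr
    have hr₂' := congrArg Prod.snd hr
    simp only [Prod.fst_add, Prod.snd_add, Prod.smul_fst, Prod.smul_snd, smul_eq_mul, mul_zero,
      add_zero, zero_add] at hr₁' hr₂'
    exact ⟨hr₁'.symm, hr₂'.symm⟩
  have h12 : r₁ * z = r₂ * z := by
    obtain ⟨r, hr, hr'⟩ := htw 1
    simp only [map_one, one_mul] at hr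
    rw [hr, hr']
  have hinv : ∀ t, u (φ t) * (r₁ * z) = r₁ * z * u t := by
    intro t
    obtain ⟨r, hr, hr'⟩ := htw t
    rw [hr, h12, hr', hcomm (u t), mul_assoc]
  let aug : E →+* ZMod (p ^ (j + 1)) :=
    (MonoidAlgebra.lift (ZMod (p ^ (j + 1))) (ZMod (p ^ (j + 1))) (SurfaceGroup g ⧸ N) 1).toRingHom
  have haug : ∀ v : E, aug v = ∑ x, v.coeff x := by
    intro v
    change MonoidAlgebra.lift _ _ _ 1 v = _
    rw [MonoidAlgebra.lift_apply, Finsupp.sum_fintype _ _ (by simp)]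
    simp
  have hzne : aug z ≠ 0 := by
    rw [hz, map_natCast, Ne, ZMod.natCast_eq_zero_iff]
    intro hdvd
    have := Nat.le_of_dvd (pow_pos hp.pos j) hdvd
    exact absurd this (not_le.2 (Nat.pow_lt_pow_right hp.one_lt (Nat.lt_succ_self j)))
  have hsum : ∑ x, (r₁ * z).coeff x ≠ 0 := by
    rw [← haug]
    intro h0
    let I : Submodule E E := RingHom.ker aug
    refine hzne ?_
    have := (hmem (I.comap (LinearMap.fst E E E)) n₁ hn₁).1 (by rw [hd₁]; exact h0)
    rw [h₁] at this
    exact this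
  have hNφ : N ≤ N.comap φ := fun n hn => hφN n hn
  obtain ⟨c, hc⟩ := exists_conj_of_sum_ne_zero (isPGroup_quotient_of_index hN)
    (QuotientGroup.map N N φ hNφ) (r₁ * z).coeff (fun x => by
      have : p • (r₁ * z) = 0 := by
        rw [hz, ← Nat.cast_smul_eq_nsmul E, smul_eq_mul, ← mul_assoc, (Nat.cast_commute p r₁).eq,
          mul_assoc, ← Nat.cast_mul, ← pow_succ', (Nat.cast_commute _ r₁).symm.eq, ← smul_eq_mul,
          Nat.cast_smul_eq_nsmul, hpE]
      rw [← Finsupp.smul_apply, ← MonoidAlgebra.coeff_smul, this]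
      rfl)
    (fun t x => by
      induction t using QuotientGroup.induction_on with
      | H t =>
        have := congrArg (
          fun v => v.coeff ((φ t : SurfaceGroup g ⧸ N) * x)) (hinv t)
        rw [QuotientGroup.map_mk, ← coeff_mul_quotientAction]
        refine this.symm.trans ((coeff_quotientAction_mul _ _ _ _).trans ?_)
        rw [inv_mul_cancel_left]) hsum
  obtain ⟨h, rfl⟩ := QuotientGroup.mk_surjective c
  exact ⟨h, fun x => hc x⟩

end

/-- The support of a derivation that is concentrated on a single generator is controlled
independently of the coefficients. -/
theorem exists_finite_mem_closure {g : ℕ} (y : Fin g × Bool) (t : SurfaceGroup g) :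
    ∃ P : Set (SurfaceGroup g), P.Finite ∧
      ∀ (R : Type) [Ring R] (u : SurfaceGroup g →* R) (d : SurfaceGroup g → R) (ν : R),
        IsDeriv u d → d (SurfaceGroup.gen y) = u (SurfaceGroup.gen y) * ν →
        (∀ x, x ≠ y → d (SurfaceGroup.gen x) = 0) →
        d t ∈ AddSubgroup.closure ((fun w => u w * ν) '' P) := by
  let A : SurfaceGroup g → Set (SurfaceGroup g) → Prop := fun t P =>
    ∀ (R : Type) [Ring R] (u : SurfaceGroup g →* R) (d : SurfaceGroup g → R) (ν : R),
        IsDeriv u d → d (SurfaceGroup.gen y) = u (SurfaceGroup.gen y) * ν →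
        (∀ x, x ≠ y → d (SurfaceGroup.gen x) = 0) →
        d t ∈ AddSubgroup.closure ((fun w => u w * ν) '' P)
  have hshift : ∀ (s t : SurfaceGroup g) (P : Set (SurfaceGroup g)), A t P →
      ∀ (R : Type) [Ring R] (u : SurfaceGroup g →* R) (d : SurfaceGroup g → R) (ν : R),
        IsDeriv u d → d (SurfaceGroup.gen y) = u (SurfaceGroup.gen y) * ν →
        (∀ x, x ≠ y → d (SurfaceGroup.gen x) = 0) →
        u s * d t ∈ AddSubgroup.closure ((fun w => u w * ν) '' ((fun w => s * w) '' P)) := by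
    intro s t P hP R _ u d ν h1 h2 h3
    have h4 := hP R u d ν h1 h2 h3
    have h5 : AddSubgroup.closure ((fun w => u w * ν) '' P) ≤
        (AddSubgroup.closure ((fun w => u w * ν) '' ((fun w => s * w) '' P))).comap
          (AddMonoidHom.mulLeft (u s)) := by
      rw [AddSubgroup.closure_le]
      rintro _ ⟨w, hw, rfl⟩
      refine AddSubgroup.subset_closure ⟨s * w, ⟨w, hw, rfl⟩, ?_⟩
      simp [mul_assoc]
    exact h5 h4
  let K : Subgroup (SurfaceGroup g) :=
    { carrier := {t | ∃ P : Set (SurfaceGroup g), P.Finite ∧ A t P}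
      one_mem' := ⟨∅, Set.finite_empty, fun R _ u d ν h _ _ => by
        rw [h.map_one]
        exact zero_mem _⟩
      mul_mem' := by
        rintro s t ⟨P, hP, hP'⟩ ⟨Q, hQ, hQ'⟩
        refine ⟨P ∪ (fun w => s * w) '' Q, hP.union (hQ.image _), fun R _ u d ν h1 h2 h3 => ?_⟩
        rw [h1, Set.image_union]
        exact add_mem (AddSubgroup.closure_mono Set.subset_union_left (hP' R u d ν h1 h2 h3))
          (AddSubgroup.closure_mono Set.subset_union_right (hshift s t Q hQ' R u d ν h1 h2 h3))
      inv_mem' := by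
        rintro s ⟨P, hP, hP'⟩
        refine ⟨(fun w => s⁻¹ * w) '' P, hP.image _, fun R _ u d ν h1 h2 h3 => ?_⟩
        rw [h1.map_inv]
        exact neg_mem (hshift s⁻¹ s P hP' R u d ν h1 h2 h3) }
  refine SurfaceGroup.mem_of_gen_mem (K := K) (fun x => ?_) t
  by_cases hx : x = y
  · subst hx
    refine ⟨{SurfaceGroup.gen x}, Set.finite_singleton _, fun R _ u d ν _ h2 _ => ?_⟩
    rw [h2]
    exact AddSubgroup.subset_closure ⟨_, rfl, rfl⟩
  · refine ⟨∅, Set.finite_empty, fun R _ u d ν _ _ h3 => ?_⟩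
    rw [h3 x hx]
    exact zero_mem _

/-- The derivation with `aᵢ ↦ aᵢ ν`, all other generators going to zero. -/
theorem exists_isDeriv_single {g : ℕ} (i : Fin g) {R : Type*} [Ring R]
    (u : SurfaceGroup g →* R) (ν : R) (hν : u (SurfaceGroup.gen (i, false)) * ν = ν) :
    ∃ d : SurfaceGroup g → R, IsDeriv u d ∧
      d (SurfaceGroup.gen (i, true)) = u (SurfaceGroup.gen (i, true)) * ν ∧
      ∀ x, x ≠ (i, true) → d (SurfaceGroup.gen x) = 0 := by
  classical
  obtain ⟨d, hd, hdα⟩ := exists_isDeriv_of_commutator u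
    (fun x => if x = (i, true) then u (SurfaceGroup.gen x) * ν else 0) (fun j => by
      set α : Fin g × Bool → R := fun x => if x = (i, true) then u (SurfaceGroup.gen x) * ν else 0
        with hα
      have h := isDeriv_freeDeriv u α
      have hb : freeDeriv u α (FreeGroup.of (j, false)) = 0 := by
        rw [freeDeriv_of, hα]
        simp
      by_cases hj : j = i
      · subst hj
        have ha : freeDeriv u α (FreeGroup.of (j, true)) = u (SurfaceGroup.gen (j, true)) * ν := by
          rw [freeDeriv_of, hα]
          simp
        rw [h, h, h, h.map_inv, h.map_inv, hb, ha]
        have hinv : u (SurfaceGroup.gen (j, true))⁻¹ * u (SurfaceGroup.gen (j, true)) = 1 := by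
          rw [← map_mul, inv_mul_cancel, map_one]
        simp only [MonoidHom.comp_apply, map_mul, SurfaceGroup.proj_of, mul_zero, neg_zero,
          add_zero, smul_eq_mul, mul_neg, map_inv SurfaceGroup.proj]
        rw [← mul_assoc (u _⁻¹), hinv, one_mul, mul_assoc, hν, add_neg_cancel]
      · have ha : freeDeriv u α (FreeGroup.of (j, true)) = 0 := by
          rw [freeDeriv_of, hα]
          simp [hj]
        rw [h, h, h, h.map_inv, h.map_inv, hb, ha]
        simp)
  exact ⟨d, hd, by rw [hdα, if_pos rfl], fun x hx => by rw [hdα, if_neg hx]⟩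

theorem coeff_sum_apply {k G ι : Type*} [Semiring k] (s : Finset ι) (f : ι → MonoidAlgebra k G)
    (c : G) : (∑ j ∈ s, f j).coeff c = ∑ j ∈ s, (f j).coeff c := by
  rw [MonoidAlgebra.coeff_sum, Finsupp.finsetSum_apply]

/-- If `φ` is inner modulo a sufficiently small normal subgroup of `p`-power index, the conjugating
element lies, modulo `N`, in one of finitely many double translates of `⟨bᵢ⟩⟨aᵢ⟩`. -/
theorem exists_finite_conj_mod {p : ℕ} [Fact p.Prime] {g : ℕ} (i : Fin g)
    (φ : SurfaceGroup g →* SurfaceGroup g) :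
    ∃ P : Set (SurfaceGroup g), P.Finite ∧ ∀ (N : Subgroup (SurfaceGroup g)) [N.Normal],
      (∃ k : ℕ, N.index = p ^ k) → ∃ N' : Subgroup (SurfaceGroup g), N'.Normal ∧
        (∃ k : ℕ, N'.index = p ^ k) ∧ N' ≤ N ∧ ∀ h : SurfaceGroup g,
          (∀ x, (h * x * h⁻¹)⁻¹ * φ x ∈ N') → ∃ w ∈ P, ∃ j k : ℕ,
            (h : SurfaceGroup g ⧸ N) = (w * SurfaceGroup.gen (i, false) ^ j *
              SurfaceGroup.gen (i, true) ^ k : SurfaceGroup g) := by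
  classical
  have hp : p.Prime := Fact.out
  set a := SurfaceGroup.gen (i, true) with ha
  set b := SurfaceGroup.gen (i, false) with hb
  obtain ⟨P, hP, hPd⟩ := exists_finite_mem_closure (i, true) (φ a)
  refine ⟨P, hP, fun N _ hN => ?_⟩
  have hfin := finite_quotient_of_index hN
  have := Fintype.ofFinite (SurfaceGroup g ⧸ N)
  let q := Nat.card (SurfaceGroup g ⧸ N)
  have hq : 0 < q := Nat.card_pos
  let s := q * q
  have hs : s < p ^ s := Nat.lt_pow_self hp.one_lt
  let E := MonoidAlgebra (ZMod (p ^ s)) (SurfaceGroup g ⧸ N)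
  have : NeZero (p ^ s) := ⟨pow_ne_zero _ hp.ne_zero⟩
  have : Finite E := Finite.of_injective _ (MonoidAlgebra.coeff_injective.comp Function.injective_id)
  have hpE : ∀ v : E, p ^ s • v = 0 := fun v => by
    rw [← Nat.cast_smul_eq_nsmul (ZMod (p ^ s)), ZMod.natCast_self, zero_smul]
  let u : SurfaceGroup g →* E := quotientAction (ZMod (p ^ s)) N
  have hpow : ∀ t : SurfaceGroup g, t ^ q ∈ N := fun t => by
    rw [← QuotientGroup.eq_one_iff, QuotientGroup.mk_pow]
    exact pow_card_eq_one'
  have hu1 : ∀ n ∈ N, u n = 1 := fun n hn => quotientAction_eq_one _ hn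
  let ν : E := ∑ j ∈ Finset.range q, u b ^ j
  have hcoeff : ∀ t c, (u t).coeff c = if (t : SurfaceGroup g ⧸ N) = c then 1 else 0 := fun t c =>
    Finsupp.single_apply
  have hν : ∀ c, ν.coeff c = ∑ j ∈ Finset.range q, if ((b ^ j : SurfaceGroup g) : SurfaceGroup g ⧸ N) = c then 1 else 0 := by
    intro c
    refine (coeff_sum_apply _ _ _).trans (Finset.sum_congr rfl fun j _ => ?_)
    rw [← map_pow, hcoeff]
  obtain ⟨d, hd, hda, hd0⟩ := exists_isDeriv_single i u ν (by
    have h1 : (u b - 1) * ν = 0 := by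
      rw [mul_geom_sum, ← map_pow, hu1 _ (hpow b), sub_self]
    rwa [sub_mul, one_mul, sub_eq_zero] at h1)
  obtain ⟨N', hN'n, hN'p, hN'⟩ := hd.exists_subgroup_index hu1 hN hpE (⊥ : Submodule E E)
  have hle : N' ≤ N := fun x hx => ((hN' x).1 hx).1
  refine ⟨N', hN'n, hN'p, hle, fun h hh => ?_⟩
  have hdφ : ∀ x ∈ N, d (φ x) = u h * d x := by
    intro x hx
    have h1 := hd (h * x * h⁻¹) ((h * x * h⁻¹)⁻¹ * φ x)
    rw [mul_inv_cancel_left, (Submodule.mem_bot E).1 ((hN' _).1 (hh x)).2, smul_zero, add_zero,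
      hd.map_conj h (hu1 x hx)] at h1
    exact h1
  have hne : (d (a ^ q)).coeff 1 ≠ 0 := by
    have h1 : (d (a ^ q)).coeff 1 = ((∑ k ∈ Finset.range q, ∑ j ∈ Finset.range q,
        if ((b ^ j : SurfaceGroup g) : SurfaceGroup g ⧸ N) = ((a ^ (k + 1) : SurfaceGroup g) : SurfaceGroup g ⧸ N)⁻¹
        then 1 else 0 : ℕ) : ZMod (p ^ s)) := by
      rw [hd.map_pow, hda]
      push_cast
      refine (coeff_sum_apply _ _ _).trans (Finset.sum_congr rfl fun k _ => ?_)
      rw [smul_eq_mul, ← mul_assoc, ← pow_succ, ← map_pow]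
      refine (coeff_quotientAction_mul _ _ _ _).trans ?_
      rw [mul_one, hν]
    rw [h1, Ne, ZMod.natCast_eq_zero_iff]
    intro hdvd
    have hle : (∑ k ∈ Finset.range q, ∑ j ∈ Finset.range q,
        if ((b ^ j : SurfaceGroup g) : SurfaceGroup g ⧸ N) = ((a ^ (k + 1) : SurfaceGroup g) : SurfaceGroup g ⧸ N)⁻¹
        then 1 else 0) ≤ q * q := by
      calc _ ≤ ∑ k ∈ Finset.range q, ∑ j ∈ Finset.range q, 1 :=
            Finset.sum_le_sum fun k _ => Finset.sum_le_sum fun j _ => by split_ifs <;> simp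
        _ = q * q := by simp
    have hpos : 0 < (∑ k ∈ Finset.range q, ∑ j ∈ Finset.range q,
        if ((b ^ j : SurfaceGroup g) : SurfaceGroup g ⧸ N) = ((a ^ (k + 1) : SurfaceGroup g) : SurfaceGroup g ⧸ N)⁻¹
        then 1 else 0) := by
      refine Finset.sum_pos' (fun _ _ => Nat.zero_le _) ⟨q - 1, Finset.mem_range.2 (by omega), ?_⟩
      refine Finset.sum_pos' (fun _ _ => Nat.zero_le _) ⟨0, Finset.mem_range.2 hq, ?_⟩
      rw [Nat.sub_add_cancel hq, (QuotientGroup.eq_one_iff _).2 (hpow a), if_pos (by simp)]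
      exact one_pos
    exact absurd (Nat.le_of_dvd hpos hdvd) (not_le.2 (hle.trans_lt hs))
  have h1 : (u h * d (a ^ q)).coeff h ≠ 0 := by
    intro h0
    refine hne (Eq.trans ?_ h0)
    refine Eq.trans ?_ (coeff_quotientAction_mul _ _ _ _).symm
    rw [inv_mul_cancel]
  rw [← hdφ _ (hpow a), map_pow, hd.map_pow] at h1
  obtain ⟨k, -, hk⟩ := Finset.exists_ne_zero_of_sum_ne_zero
    fun h0 => h1 ((coeff_sum_apply _ _ _).trans h0)
  rw [← map_pow, smul_eq_mul] at hk
  have hk' := fun h0 => hk ((coeff_quotientAction_mul _ _ _ _).trans h0)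
  clear hk h1
  set c := ((φ a ^ k : SurfaceGroup g) : SurfaceGroup g ⧸ N)⁻¹ * h with hc
  obtain ⟨w, hw, hwc⟩ : ∃ w ∈ P, (u w * ν).coeff c ≠ 0 := by
    by_contra! hcon
    have h2 : AddSubgroup.closure ((fun w => u w * ν) '' P) ≤
        (⊥ : AddSubgroup (ZMod (p ^ s))).comap
          ((Finsupp.applyAddHom c).comp MonoidAlgebra.coeffAddEquiv.toAddMonoidHom) := by
      rw [AddSubgroup.closure_le]
      rintro _ ⟨w, hw, rfl⟩
      exact hcon w hw
    exact hk' (h2 (hPd E u d ν hd hda hd0))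
  have hwc' := fun h0 => hwc ((coeff_quotientAction_mul _ _ _ _).trans h0)
  rw [hν] at hwc'
  obtain ⟨j, -, hj⟩ := Finset.exists_ne_zero_of_sum_ne_zero hwc'
  have hj' : ((b ^ j : SurfaceGroup g) : SurfaceGroup g ⧸ N) = (w : SurfaceGroup g ⧸ N)⁻¹ * c := by
    by_contra hcon
    exact hj (if_neg hcon)
  have hφa : ((φ a ^ k : SurfaceGroup g) : SurfaceGroup g ⧸ N) =
      (h : SurfaceGroup g ⧸ N) * ((a ^ k : SurfaceGroup g) : SurfaceGroup g ⧸ N) * (h : SurfaceGroup g ⧸ N)⁻¹ := by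
    have h3 : ((h * a ^ k * h⁻¹ : SurfaceGroup g) : SurfaceGroup g ⧸ N) = φ (a ^ k) :=
      QuotientGroup.eq.2 (hle (hh (a ^ k)))
    rw [← map_pow, ← h3]
    rfl
  refine ⟨w, hw, j, k, ?_⟩
  rw [hc, hφa] at hj'
  change (h : SurfaceGroup g ⧸ N) = (w : SurfaceGroup g ⧸ N) * ((b ^ j : SurfaceGroup g) : SurfaceGroup g ⧸ N) *
    ((a ^ k : SurfaceGroup g) : SurfaceGroup g ⧸ N)
  rw [hj']
  group

section FreeGroup

/-- A nontrivial element of a free group is a nonempty product of nontrivial powers of generators,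
consecutive generators being distinct. -/
theorem exists_eq_prod_zpow_of_ne_one {ι : Type*} {x : FreeGroup ι} (hx : x ≠ 1) :
    ∃ L : List (ι × ℤ), L ≠ [] ∧ (∀ l ∈ L, l.2 ≠ 0) ∧ L.IsChain (fun l l' => l.1 ≠ l'.1) ∧
      x = (L.map fun l => FreeGroup.of l.1 ^ l.2).prod := by
  classical
  let w := Monoid.CoprodI.Word.equiv (freeGroupEquivCoprodI x)
  have hw : x = freeGroupEquivCoprodI.symm w.prod := by
    rw [MulEquiv.eq_symm_apply]
    exact (Monoid.CoprodI.Word.equiv.symm_apply_apply _).symm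
  refine ⟨w.toList.map fun l => (l.1, FreeGroup.freeGroupUnitEquivInt l.2), ?_, ?_, ?_, ?_⟩
  · intro h
    refine hx ?_
    rw [hw, Monoid.CoprodI.Word.prod, List.map_eq_nil_iff.1 h, List.map_nil, List.prod_nil,
      map_one]
  · intro l hl h0
    obtain ⟨l', hl', rfl⟩ := List.mem_map.1 hl
    refine w.ne_one l' hl' ?_
    have h1 := FreeGroup.freeGroupUnitEquivInt.symm_apply_apply l'.2
    rw [show FreeGroup.freeGroupUnitEquivInt l'.2 = 0 from h0] at h1
    rw [← h1]
    exact zpow_zero _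
  · rw [List.isChain_map]
    exact w.chain_ne
  · conv_lhs => rw [hw, Monoid.CoprodI.Word.prod, map_list_prod]
    rw [List.map_map, List.map_map]
    congr 1
    refine List.map_congr_left fun l _ => ?_
    have h1 := FreeGroup.freeGroupUnitEquivInt.symm_apply_apply l.2
    change freeGroupEquivCoprodI.symm (Monoid.CoprodI.of l.2) =
      FreeGroup.of l.1 ^ FreeGroup.freeGroupUnitEquivInt l.2
    conv_lhs => rw [← h1]
    change freeGroupEquivCoprodI.symm (Monoid.CoprodI.of
      (FreeGroup.of () ^ FreeGroup.freeGroupUnitEquivInt l.2)) = _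
    rw [map_zpow, map_zpow]
    congr 1

end FreeGroup

section Unitriangular

/-- The group of upper unitriangular matrices. -/
def unitriangular (n : ℕ) (R : Type*) [Ring R] : Subgroup (Matrix (Fin n) (Fin n) R)ˣ where
  carrier := {u | (∀ a b, b ≤ a → (u.val - 1) a b = 0) ∧ ∀ a b, b ≤ a → (u⁻¹.val - 1) a b = 0}
  one_mem' := by simp
  mul_mem' := by
    have key : ∀ u v : Matrix (Fin n) (Fin n) R, (∀ a b, b ≤ a → (u - 1) a b = 0) →
        (∀ a b, b ≤ a → (v - 1) a b = 0) → ∀ a b, b ≤ a → (u * v - 1) a b = 0 := by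
      intro u v hu hv a b hab
      have h : u * v - 1 = (u - 1) * (v - 1) + (u - 1) + (v - 1) := by noncomm_ring
      rw [h, Matrix.add_apply, Matrix.add_apply, hu a b hab, hv a b hab, Matrix.mul_apply,
        add_zero, add_zero]
      refine Finset.sum_eq_zero fun c _ => ?_
      rcases le_total c a with hc | hc
      · rw [hu a c hc, zero_mul]
      · rw [hv c b (hab.trans hc), mul_zero]
    rintro u v ⟨hu, hu'⟩ ⟨hv, hv'⟩
    exact ⟨key _ _ hu hv, by rw [mul_inv_rev]; exact key _ _ hv' hu'⟩
  inv_mem' := fun ⟨hu, hu'⟩ => ⟨hu', by rwa [inv_inv]⟩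

theorem pow_eq_zero_of_strictUpper {n : ℕ} {R : Type*} [Ring R] {X : Matrix (Fin n) (Fin n) R}
    (hX : ∀ a b, b ≤ a → X a b = 0) {k : ℕ} (hk : n ≤ k) : X ^ k = 0 := by
  have h : ∀ (m : ℕ) (a b : Fin n), (b : ℕ) < a + m → (X ^ m) a b = 0 := by
    intro m
    induction m with
    | zero =>
      intro a b hab
      rw [pow_zero, Matrix.one_apply_ne]
      rintro rfl
      simp at hab
    | succ m ih =>
      intro a b hab
      rw [pow_succ, Matrix.mul_apply]
      refine Finset.sum_eq_zero fun c _ => ?_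
      rcases lt_or_ge (c : ℕ) (a + m) with hc | hc
      · rw [ih a c hc, zero_mul]
      · rw [hX c b (Fin.le_def.2 (by omega)), mul_zero]
  ext a b
  rw [h k a b (by omega), Matrix.zero_apply]

/-- A unipotent element has `p`-power order when `p` is nilpotent. -/
theorem one_add_pow_prime_pow_eq_one {p : ℕ} (hp : p.Prime) {R : Type*} [Ring R] {s m : ℕ}
    (hs : (p : R) ^ s = 0) {X : R} (hX : X ^ p ^ m = 0) : (1 + X) ^ p ^ (m + s) = 1 := by
  have h1 : ((p : ℕ) : Polynomial ℤ) ∣ (1 + Polynomial.X) ^ p ^ m - (1 + Polynomial.X ^ p ^ m) := by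
    obtain ⟨r, hr⟩ := exists_add_pow_prime_pow_eq hp (1 : Polynomial ℤ) Polynomial.X m
    refine ⟨Polynomial.X * r, ?_⟩
    rw [hr]
    ring
  obtain ⟨r, hr⟩ := dvd_sub_pow_of_dvd_sub h1 s
  have h2 := congrArg (Polynomial.aeval X) hr
  simp only [map_sub, map_pow, map_add, map_mul, map_one, Polynomial.aeval_X, map_natCast, hX,
    pow_succ, hs, zero_mul, add_zero, one_pow] at h2
  rw [pow_add, pow_mul]
  exact sub_eq_zero.1 h2

theorem isPGroup_unitriangular {p : ℕ} (hp : p.Prime) (n s : ℕ) :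
    IsPGroup p (unitriangular n (ZMod (p ^ s))) := by
  rintro ⟨u, hu, -⟩
  refine ⟨n + s, Subtype.ext (Units.ext ?_)⟩
  have hX : (u.val - 1) ^ p ^ n = 0 :=
    pow_eq_zero_of_strictUpper hu (Nat.lt_pow_self hp.one_lt).le
  have hs : ((p : ℕ) : Matrix (Fin n) (Fin n) (ZMod (p ^ s))) ^ s = 0 := by
    rw [← Nat.cast_pow, ← map_natCast (algebraMap (ZMod (p ^ s)) _), ZMod.natCast_self, map_zero]
  have h := one_add_pow_prime_pow_eq_one hp hs hX
  rw [add_sub_cancel] at h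
  simpa using h

theorem Units.val_zpow_of_sq_eq_zero {R : Type*} [Ring R] {E : R} (hE : E * E = 0) {u : Rˣ}
    (hu : u.val = 1 + E) (hu' : u⁻¹.val = 1 - E) (e : ℤ) : (u ^ e).val = 1 + e • E := by
  induction e using Int.induction_on with
  | zero => simp
  | succ i ih =>
    rw [zpow_add_one, Units.val_mul, ih, hu, mul_add, mul_one, add_mul, smul_mul_assoc, hE, add_smul]
    simp only [smul_zero, one_mul, one_smul]
    abel
  | pred i ih =>
    rw [zpow_sub_one, Units.val_mul, ih, hu', mul_sub, mul_one, add_mul, smul_mul_assoc, hE, sub_smul]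
    simp only [smul_zero, one_mul, one_smul]
    abel

end Unitriangular

/-- Free groups are residually `p`. -/
theorem exists_hom_freeGroup_ne_one {p : ℕ} (hp : p.Prime) {ι : Type*} {x : FreeGroup ι}
    (hx : x ≠ 1) : ∃ (P : Type) (_ : Group P) (_ : Finite P) (f : FreeGroup ι →* P),
      IsPGroup p P ∧ f x ≠ 1 := by
  classical
  obtain ⟨L, hL, hL0, hLc, rfl⟩ := exists_eq_prod_zpow_of_ne_one hx
  rw [List.isChain_iff_getElem] at hLc
  set e : ℤ := (L.map Prod.snd).prod with he
  have he0 : e ≠ 0 := by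
    refine List.prod_ne_zero fun h => ?_
    obtain ⟨l, hl, hl'⟩ := List.mem_map.1 h
    exact hL0 l hl hl'
  let s := e.natAbs
  have hs : e.natAbs < p ^ s := Nat.lt_pow_self hp.one_lt
  have : NeZero (p ^ s) := ⟨pow_ne_zero _ hp.ne_zero⟩
  let R := ZMod (p ^ s)
  let n := L.length
  let E : ι → Matrix (Fin (n + 1)) (Fin (n + 1)) R := fun i => Matrix.of fun a b =>
    if ∃ h : (a : ℕ) < L.length, (L[(a : ℕ)]).1 = i ∧ (b : ℕ) = a + 1 then 1 else 0
  have hE : ∀ i a b, E i a b =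
    if ∃ h : (a : ℕ) < L.length, (L[(a : ℕ)]).1 = i ∧ (b : ℕ) = a + 1 then 1 else 0 :=
      fun _ _ _ => rfl
  have hEE : ∀ i, E i * E i = 0 := by
    intro i
    ext a b
    rw [Matrix.mul_apply, Matrix.zero_apply]
    refine Finset.sum_eq_zero fun c _ => ?_
    rw [hE, hE]
    split_ifs with h1 h2
    · obtain ⟨h1, h3, h4⟩ := h1
      obtain ⟨h2, h5, h6⟩ := h2
      refine absurd ?_ (hLc a (by omega))
      rw [h3]
      simp only [h4] at h5
      exact h5.symm
    all_goals simp
  have hEu : ∀ i a b, b ≤ a → E i a b = 0 := by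
    intro i a b hab
    rw [hE, if_neg]
    rintro ⟨-, -, h⟩
    have := Fin.le_def.1 hab
    omega
  let y : ι → unitriangular (n + 1) R := fun i =>
    ⟨⟨1 + E i, 1 - E i, by rw [add_mul, mul_sub, mul_sub, hEE]; simp,
      by rw [sub_mul, mul_add, mul_add, hEE]; simp⟩, by
      refine ⟨fun a b hab => ?_, fun a b hab => ?_⟩
      · change (1 + E i - 1) a b = 0
        rw [add_sub_cancel_left, hEu i a b hab]
      · change (1 - E i - 1) a b = 0
        rw [sub_sub_cancel_left, Matrix.neg_apply, hEu i a b hab, neg_zero]⟩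
  refine ⟨unitriangular (n + 1) R, inferInstance, inferInstance, FreeGroup.lift y,
    isPGroup_unitriangular hp _ _, fun h => ?_⟩
  let M : ℕ → Matrix (Fin (n + 1)) (Fin (n + 1)) R := fun k =>
    ((FreeGroup.lift y ((L.map fun l => FreeGroup.of l.1 ^ l.2).take k).prod).1).val
  have hM : ∀ (k : ℕ) (hk : k < L.length), M (k + 1) = M k * (1 + (L[k]).2 • E (L[k]).1) := by
    intro k hk
    simp only [M]
    rw [List.prod_take_succ _ _ (by simpa using hk), map_mul, List.getElem_map, map_zpow,
      FreeGroup.lift_apply_of, Subgroup.coe_mul, Units.val_mul, Subgroup.coe_zpow,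
      Units.val_zpow_of_sq_eq_zero (hEE _) rfl rfl]
  have hMk : ∀ k (hk : k < n + 1), M k 0 ⟨k, hk⟩ = (((L.map Prod.snd).take k).prod : ℤ) ∧
      ∀ b : Fin (n + 1), k < b → M k 0 b = 0 := by
    intro k
    induction k with
    | zero =>
      intro hk
      simp only [M, List.take_zero, List.prod_nil, map_one, Subgroup.coe_one, Units.val_one]
      refine ⟨by simp; exact Matrix.one_apply_eq _, fun b hb => Matrix.one_apply_ne ?_⟩
      rintro rfl
      simp at hb
    | succ k ih =>
      intro hk
      have hk' : k < L.length := by omega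
      obtain ⟨h1, h2⟩ := ih (by omega)
      have h3 : ∀ b : Fin (n + 1), k < b → M (k + 1) 0 b =
          ((L[k]).2 : R) * ∑ c, M k 0 c * E (L[k]).1 c b := by
        intro b hb
        rw [hM k hk', mul_add, mul_one, Matrix.add_apply, h2 b hb, zero_add, mul_smul_comm,
          Matrix.smul_apply, Matrix.mul_apply, zsmul_eq_mul]
      refine ⟨?_, fun b hb => ?_⟩
      · rw [h3 _ (Nat.lt_succ_self k), List.prod_take_succ _ _ (by simpa using hk'),
          List.getElem_map, Finset.sum_eq_single (⟨k, by omega⟩ : Fin (n + 1)), h1, hE,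
          if_pos ⟨hk', rfl, rfl⟩]
        · push_cast
          ring
        · intro c _ hc
          rw [hE, if_neg, mul_zero]
          rintro ⟨-, -, h⟩
          exact hc (Fin.ext (by simpa using h.symm))
        · simp
      · rw [h3 b (by omega), Finset.sum_eq_zero, mul_zero]
        intro c _
        rcases lt_or_ge k (c : ℕ) with hc | hc
        · rw [h2 c hc, zero_mul]
        · rw [hE, if_neg, mul_zero]
          rintro ⟨-, -, h⟩
          omega
  have h1 := (hMk n (Nat.lt_succ_self n)).1
  have h2 : M n = 1 := by
    simp only [M]
    rw [List.take_of_length_le (by simp [n]), h]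
    rfl
  rw [h2, List.take_of_length_le (by simp [n]), Matrix.one_apply_ne] at h1
  · have h3 := (ZMod.intCast_zmod_eq_zero_iff_dvd _ _).1 h1.symm
    have h4 := Int.natAbs_dvd_natAbs.2 h3
    rw [Int.natAbs_natCast] at h4
    exact absurd (Nat.le_of_dvd (Int.natAbs_pos.2 he0) h4) (not_le.2 hs)
  · have := List.length_pos_iff.2 hL
    intro h0
    have := congrArg Fin.val h0
    simp only [Fin.val_zero] at this
    omega

theorem surfaceWord_succ {H : Type*} [Group H] {g : ℕ} (y : Fin (g + 1) × Bool → H) :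
    surfaceWord y = y (0, true) * y (0, false) * (y (0, true))⁻¹ * (y (0, false))⁻¹ *
      surfaceWord fun x : Fin g × Bool => y (x.1.succ, x.2) := by
  rw [surfaceWord, List.ofFn_succ, List.prod_cons]
  rfl

/-- The exponent sum of a generator. -/
def SurfaceGroup.degree {g : ℕ} (y : Fin g × Bool) : SurfaceGroup g →* Multiplicative ℤ :=
  SurfaceGroup.lift (fun x => if x = y then Multiplicative.ofAdd 1 else 1) (surfaceWord_of_comm _)

theorem SurfaceGroup.degree_gen_self {g : ℕ} (y : Fin g × Bool) :
    SurfaceGroup.degree y (SurfaceGroup.gen y) = Multiplicative.ofAdd 1 := by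
  rw [SurfaceGroup.degree, SurfaceGroup.lift_gen, if_pos rfl]

theorem SurfaceGroup.degree_gen_of_ne {g : ℕ} {x y : Fin g × Bool} (h : x ≠ y) :
    SurfaceGroup.degree y (SurfaceGroup.gen x) = 1 := by
  rw [SurfaceGroup.degree, SurfaceGroup.lift_gen, if_neg h]

/-- The exponent sum of a generator, modulo `q`. -/
def SurfaceGroup.degreeMod {g : ℕ} (y : Fin g × Bool) (q : ℕ) :
    SurfaceGroup g →* Multiplicative (ZMod q) :=
  (AddMonoidHom.toMultiplicative (Int.castAddHom (ZMod q))).comp (SurfaceGroup.degree y)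

theorem SurfaceGroup.degreeMod_apply {g : ℕ} (y : Fin g × Bool) (q : ℕ) (t : SurfaceGroup g) :
    SurfaceGroup.degreeMod y q t =
      Multiplicative.ofAdd (((SurfaceGroup.degree y t).toAdd : ℤ) : ZMod q) := rfl

theorem isPGroup_multiplicative_zmod (p s : ℕ) : IsPGroup p (Multiplicative (ZMod (p ^ s))) :=
  IsPGroup.of_card (n := s) (by rw [Nat.card_congr Multiplicative.toAdd, Nat.card_zmod])

section Residual

theorem FreeGroup.map_mem_of_forall_of {α G : Type*} [Group G] (f : FreeGroup α →* G)
    {H : Subgroup G} (h : ∀ a, f (FreeGroup.of a) ∈ H) (k : FreeGroup α) : f k ∈ H := by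
  induction k using FreeGroup.induction_on with
  | C1 => rw [_root_.map_one]; exact one_mem _
  | of a => exact h a
  | inv_of a _ => rw [_root_.map_inv]; exact inv_mem (h a)
  | mul x y hx hy => rw [_root_.map_mul]; exact mul_mem hx hy

variable {g : ℕ}

/-- The parametrization, by a free group, of the kernel of the exponent sum of the generator
`b₀`. -/
def coverHom (g : ℕ) : FreeGroup (Option (ℤ × (Fin g × Bool))) →* SurfaceGroup (g + 1) :=
  FreeGroup.lift fun o => o.elim (SurfaceGroup.gen (0, true)) fun z =>
    SurfaceGroup.gen (0, false) ^ z.1 * SurfaceGroup.gen (z.2.1.succ, z.2.2) *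
      (SurfaceGroup.gen (0, false) ^ z.1)⁻¹

theorem coverHom_of_none : coverHom g (FreeGroup.of none) = SurfaceGroup.gen (0, true) :=
  FreeGroup.lift_apply_of

theorem coverHom_of_some (m : ℤ) (y : Fin g × Bool) : coverHom g (FreeGroup.of (some (m, y))) =
    SurfaceGroup.gen (0, false) ^ m * SurfaceGroup.gen (y.1.succ, y.2) *
      (SurfaceGroup.gen (0, false) ^ m)⁻¹ :=
  FreeGroup.lift_apply_of

theorem conj_gen_eq : SurfaceGroup.gen (0, false) * SurfaceGroup.gen (0, true) *
    (SurfaceGroup.gen (0, false))⁻¹ =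
      surfaceWord (fun x : Fin g × Bool => SurfaceGroup.gen (g := g + 1) (x.1.succ, x.2)) *
        SurfaceGroup.gen (0, true) := by
  have h := SurfaceGroup.surfaceWord_gen (g := g + 1)
  rw [surfaceWord_succ] at h
  rw [eq_inv_of_mul_eq_one_right h]
  group

theorem coverHom_range_normal : (coverHom g).range.Normal := by
  have hy : ∀ m : ℤ, ∀ y : Fin g × Bool, SurfaceGroup.gen (0, false) ^ m *
      SurfaceGroup.gen (y.1.succ, y.2) * (SurfaceGroup.gen (0, false) ^ m)⁻¹ ∈
        (coverHom g).range := fun m y => ⟨_, coverHom_of_some m y⟩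
  have ha : SurfaceGroup.gen (0, true) ∈ (coverHom g).range := ⟨_, coverHom_of_none⟩
  have hw : ∀ m : ℤ, SurfaceGroup.gen (0, false) ^ m *
      surfaceWord (fun x : Fin g × Bool => SurfaceGroup.gen (g := g + 1) (x.1.succ, x.2)) *
        (SurfaceGroup.gen (0, false) ^ m)⁻¹ ∈ (coverHom g).range := by
    intro m
    rw [← MulAut.conj_apply, ← MulEquiv.coe_toMonoidHom, map_surfaceWord]
    exact surfaceWord_mem (K := (coverHom g).range.toSubmonoid) fun i =>
      (coverHom g).range.mul_mem (mul_mem (mul_mem (hy m (i, true)) (hy m (i, false)))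
        (inv_mem (hy m (i, true)))) (inv_mem (hy m (i, false)))
  have key : ∀ c : SurfaceGroup (g + 1), (∀ o, c * coverHom g (FreeGroup.of o) * c⁻¹ ∈
      (coverHom g).range) → ∀ t ∈ (coverHom g).range, c * t * c⁻¹ ∈ (coverHom g).range := by
    rintro c hc _ ⟨k, rfl⟩
    exact FreeGroup.map_mem_of_forall_of ((MulAut.conj c).toMonoidHom.comp (coverHom g)) hc k
  have hb : SurfaceGroup.gen (0, false) ∈
      Subgroup.normalizer ((coverHom g).range : Set (SurfaceGroup (g + 1))) := by
    rw [Subgroup.mem_normalizer_iff]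
    refine fun t => ⟨key _ ?_ t, fun h => ?_⟩
    · rintro (_ | ⟨m, y⟩)
      · rw [coverHom_of_none, conj_gen_eq]
        refine mul_mem ?_ ha
        simpa using hw 0
      · rw [coverHom_of_some]
        convert hy (m + 1) y using 1
        group
    · have := key (SurfaceGroup.gen (0, false))⁻¹ ?_ _ h
      · simpa [mul_assoc] using this
      rintro (_ | ⟨m, y⟩)
      · rw [coverHom_of_none]
        convert mul_mem (inv_mem (hw (-1))) ha using 1
        have h1 := conj_gen_eq (g := g)
        rw [← mul_inv_eq_iff_eq_mul] at h1
        rw [← h1]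
        group
      · rw [coverHom_of_some]
        convert hy (m - 1) y using 1
        group
  rw [← Subgroup.normalizer_eq_top_iff, eq_top_iff]
  intro t _
  refine SurfaceGroup.mem_of_gen_mem (fun x => ?_) t
  obtain ⟨i, c⟩ := x
  refine Fin.cases ?_ (fun j => ?_) i
  · cases c
    · exact hb
    · exact Subgroup.le_normalizer ha
  · refine Subgroup.le_normalizer ?_
    simpa using hy 0 (j, c)

theorem exists_eq_coverHom_mul (t : SurfaceGroup (g + 1)) :
    ∃ k, ∃ n : ℤ, t = coverHom g k * SurfaceGroup.gen (0, false) ^ n := by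
  have := coverHom_range_normal (g := g)
  have h : t ∈ (coverHom g).range ⊔ Subgroup.zpowers (SurfaceGroup.gen (0, false)) := by
    refine SurfaceGroup.mem_of_gen_mem (fun x => ?_) t
    obtain ⟨i, c⟩ := x
    refine Fin.cases ?_ (fun j => ?_) i
    · cases c
      · exact (le_sup_right : _ ≤ (coverHom g).range ⊔ _) (Subgroup.mem_zpowers _)
      · exact (le_sup_left : (coverHom g).range ≤ _) ⟨_, coverHom_of_none⟩
    · refine (le_sup_left : (coverHom g).range ≤ _)
        ⟨_, (coverHom_of_some (g := g) 0 (j, c)).trans ?_⟩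
      simp
  obtain ⟨_, ⟨k, rfl⟩, _, ⟨n, rfl⟩, h⟩ := Subgroup.mem_sup_of_normal_left.1 h
  exact ⟨k, n, h.symm⟩

/-- The base group of a regular wreath product. -/
def wreathBase (P Q : Type*) [Group P] [Group Q] : (Q → P) →* P ≀ᵣ Q where
  toFun f := ⟨f, 1⟩
  map_one' := rfl
  map_mul' f f' := by
    ext x
    · simp
    · simp

theorem wreathBase_injective (P Q : Type*) [Group P] [Group Q] :
    Function.Injective (wreathBase P Q) := fun _ _ h => congrArg RegularWreathProduct.left h

theorem inl_mul_wreathBase {P Q : Type*} [Group P] [Group Q] (z : Q) (f : Q → P) :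
    RegularWreathProduct.inl z * wreathBase P Q f * (RegularWreathProduct.inl z)⁻¹ =
      wreathBase P Q fun x => f (z⁻¹ * x) := by
  ext x
  · simp [wreathBase]
  · simp [wreathBase]

open RegularWreathProduct in
theorem exists_hom_wreath {P : Type*} [Group P] {q₀ q : ℕ} [NeZero q] (hq : q₀ ∣ q)
    (F : ZMod q₀ → Fin g × Bool → P) (c : P) (hP : ∀ x : P, x ^ (q / q₀) = 1) :
    ∃ Ψ : SurfaceGroup (g + 1) →* P ≀ᵣ Multiplicative (ZMod q), ∀ k,
      FreeGroup.lift (fun o : Option (ℤ × (Fin g × Bool)) => o.elim c fun z => F z.1 z.2) k ≠ 1 →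
        Ψ (coverHom g k) ≠ 1 := by
  let Q := Multiplicative (ZMod q)
  let W : ZMod q₀ → P := fun z => surfaceWord (F z)
  let U : ℕ → P := fun n => n.rec 1 fun m x => W m * x
  have hU : ∀ n : ℕ, U (n + 1) = W n * U n := fun _ => rfl
  have hU1 : ∀ n, U (n + q₀) = U n * U q₀ := by
    intro n
    induction n with
    | zero => rw [zero_add]; exact (one_mul _).symm
    | succ n ih => rw [add_right_comm, hU, ih, hU, Nat.cast_add, ZMod.natCast_self, add_zero,
        mul_assoc]
  have hU2 : ∀ k n, U (n + k * q₀) = U n * U q₀ ^ k := by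
    intro k
    induction k with
    | zero => simp
    | succ k ih =>
      intro n
      rw [add_mul, one_mul, ← add_assoc, hU1, ih, mul_assoc, pow_succ]
  have hUp : Function.Periodic U q := by
    intro n
    have h := hU2 (q / q₀) n
    rwa [Nat.div_mul_cancel hq, hP, mul_one] at h
  let π : ZMod q →+* ZMod q₀ := ZMod.castHom hq _
  let B : ZMod q → P := fun z => U z.val * c
  have hB : ∀ z, B (z + 1) = W (π z) * B z := by
    intro z
    have h1 : U (z + 1).val = U (z.val + 1) := by
      rw [ZMod.val_add, hUp.map_mod_nat, ZMod.val_one_eq_one_mod, ← hUp.map_mod_nat, Nat.add_mod_mod,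
        hUp.map_mod_nat]
    simp only [B]
    rw [h1, hU, mul_assoc]
    congr 2
    conv_rhs => rw [← ZMod.natCast_zmod_val z]
    rw [map_natCast]
  let Y : Fin g × Bool → Q → P := fun y x => F (π (x⁻¹).toAdd) y
  let A : Q → P := fun x => B (x⁻¹).toAdd
  let ζ : Q := Multiplicative.ofAdd 1
  let β : Fin (g + 1) × Bool → P ≀ᵣ Q := fun x => Fin.cases
    (bif x.2 then wreathBase P Q A else inl ζ) (fun j => wreathBase P Q (Y (j, x.2))) x.1
  have hβ : surfaceWord β = 1 := by
    rw [surfaceWord_succ]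
    change wreathBase P Q A * inl ζ * (wreathBase P Q A)⁻¹ * (inl ζ)⁻¹ *
      surfaceWord (fun y => wreathBase P Q (Y y)) = 1
    rw [mul_assoc (wreathBase P Q A), mul_assoc (wreathBase P Q A), ← map_inv, inl_mul_wreathBase,
      ← map_mul, ← map_surfaceWord, ← map_mul]
    refine (congrArg _ (funext fun x => ?_)).trans (map_one _)
    have h1 : surfaceWord Y x = W (π (x⁻¹).toAdd) :=
      map_surfaceWord (Pi.evalMonoidHom (fun _ : Q => P) x) Y
    have h2 : A (ζ⁻¹ * x) = W (π (x⁻¹).toAdd) * A x := by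
      rw [← hB]
      simp only [A]
      rw [mul_inv_rev, inv_inv]
      rfl
    change A x * (A (ζ⁻¹ * x))⁻¹ * surfaceWord Y x = 1
    rw [h1, h2]
    group
  refine ⟨SurfaceGroup.lift β hβ, fun k hk h => hk ?_⟩
  let Φ : FreeGroup (Option (ℤ × (Fin g × Bool))) →* (Q → P) :=
    FreeGroup.lift fun o => o.elim A fun z x => Y z.2 ((ζ ^ z.1)⁻¹ * x)
  have hΦ : (SurfaceGroup.lift β hβ).comp (coverHom g) = (wreathBase P Q).comp Φ := by
    refine FreeGroup.ext_hom _ _ ?_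
    rintro (_ | ⟨m, y⟩)
    · rw [MonoidHom.comp_apply, MonoidHom.comp_apply, coverHom_of_none, SurfaceGroup.lift_gen,
        FreeGroup.lift_apply_of]
      rfl
    · rw [MonoidHom.comp_apply, MonoidHom.comp_apply, coverHom_of_some, map_mul, map_mul, map_inv,
        map_zpow, SurfaceGroup.lift_gen, SurfaceGroup.lift_gen, FreeGroup.lift_apply_of]
      change inl ζ ^ m * wreathBase P Q (Y y) * (inl ζ ^ m)⁻¹ = _
      rw [← map_zpow, inl_mul_wreathBase]
      rfl
  have h1 : Φ k = 1 := by
    refine wreathBase_injective P Q ?_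
    rw [map_one, ← h]
    exact (DFunLike.congr_fun hΦ k).symm
  have h2 : FreeGroup.lift (fun o : Option (ℤ × (Fin g × Bool)) => o.elim c fun z => F z.1 z.2) =
      (Pi.evalMonoidHom (fun _ : Q => P) 1).comp Φ := by
    refine FreeGroup.ext_hom _ _ ?_
    rintro (_ | ⟨m, y⟩)
    · rw [MonoidHom.comp_apply, FreeGroup.lift_apply_of, FreeGroup.lift_apply_of]
      change c = B ((1 : Q)⁻¹).toAdd
      rw [inv_one, toAdd_one]
      simp only [B]
      rw [ZMod.val_zero]
      exact (one_mul c).symm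
    · rw [MonoidHom.comp_apply, FreeGroup.lift_apply_of, FreeGroup.lift_apply_of]
      change F m y = F (π (((ζ ^ m)⁻¹ * 1)⁻¹).toAdd) y
      rw [mul_one, inv_inv, toAdd_zpow, toAdd_ofAdd, zsmul_one, map_intCast]
  rw [h2, MonoidHom.comp_apply, h1]
  rfl

theorem exists_forall_map_eq {Y : Type*} (k : FreeGroup (Option (ℤ × Y))) :
    ∃ r : ℕ, ∀ q : ℕ, r < q → FreeGroup.map
      (Option.map (Prod.map (fun m : ℤ => (m : ZMod q).valMinAbs) id)) k = k := by
  induction k using FreeGroup.induction_on with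
  | C1 => exact ⟨0, fun q _ => map_one _⟩
  | of o =>
    rcases o with _ | ⟨m, y⟩
    · exact ⟨0, fun q _ => FreeGroup.map.of⟩
    · refine ⟨2 * m.natAbs, fun q hq => ?_⟩
      have : NeZero q := ⟨by omega⟩
      have h : (m : ZMod q).valMinAbs = m :=
        (ZMod.valMinAbs_spec _ _).2 ⟨rfl, Set.mem_Ioc.2 ⟨by omega, by omega⟩⟩
      rw [FreeGroup.map.of, Option.map_some, Prod.map_apply, h]
      rfl
  | inv_of o ih =>
    obtain ⟨r, hr⟩ := ih
    exact ⟨r, fun q hq => by rw [map_inv, hr q hq]⟩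
  | mul x y hx hy =>
    obtain ⟨r, hr⟩ := hx
    obtain ⟨r', hr'⟩ := hy
    exact ⟨max r r', fun q hq => by
      rw [map_mul, hr q (by omega), hr' q (by omega)]⟩

/-- Surface groups are residually `p`. -/
theorem exists_hom_surfaceGroup_ne_one {p : ℕ} (hp : p.Prime) {t : SurfaceGroup (g + 1)}
    (ht : t ≠ 1) : ∃ (P : Type) (_ : Group P) (_ : Finite P) (f : SurfaceGroup (g + 1) →* P),
      IsPGroup p P ∧ f t ≠ 1 := by
  obtain ⟨k, n, rfl⟩ := exists_eq_coverHom_mul t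
  by_cases hn : n = 0
  · subst hn
    rw [zpow_zero, mul_one] at ht ⊢
    have hk : k ≠ 1 := by
      rintro rfl
      exact ht (map_one _)
    obtain ⟨P, _, _, f, hP, hf⟩ := exists_hom_freeGroup_ne_one hp hk
    obtain ⟨r, hr⟩ := exists_forall_map_eq k
    have : Fact p.Prime := ⟨hp⟩
    obtain ⟨e, he⟩ := IsPGroup.iff_card.1 hP
    have : NeZero (p ^ (r + e)) := ⟨pow_ne_zero _ hp.ne_zero⟩
    obtain ⟨Ψ, hΨ⟩ := exists_hom_wreath (g := g) (q₀ := p ^ r) (q := p ^ (r + e)) (P := P)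
      (pow_dvd_pow p (Nat.le_add_right r e)) (fun z y => f (FreeGroup.of (some (z.valMinAbs, y))))
      (f (FreeGroup.of none)) (fun x => by
        rw [pow_add, Nat.mul_div_cancel_left _ (pow_pos hp.pos r), ← he, pow_card_eq_one'])
    refine ⟨_, inferInstance, inferInstance, Ψ, ?_, hΨ k ?_⟩
    · refine IsPGroup.of_card (n := e * p ^ (r + e) + (r + e)) ?_
      rw [RegularWreathProduct.card, he, Nat.card_congr Multiplicative.toAdd, Nat.card_zmod,
        ← pow_mul, ← pow_add]
    · refine fun h => hf ?_
      rw [← h]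
      conv_lhs => rw [← hr (p ^ r) (Nat.lt_pow_self hp.one_lt)]
      rw [← MonoidHom.comp_apply]
      refine DFunLike.congr_fun (FreeGroup.ext_hom _ _ ?_) k
      rintro (_ | ⟨m, y⟩)
      · rw [MonoidHom.comp_apply, FreeGroup.map.of, FreeGroup.lift_apply_of]
        rfl
      · rw [MonoidHom.comp_apply, FreeGroup.map.of, FreeGroup.lift_apply_of]
        rfl
  · let s := n.natAbs
    have : NeZero (p ^ s) := ⟨pow_ne_zero _ hp.ne_zero⟩
    refine ⟨_, inferInstance, inferInstance, SurfaceGroup.degreeMod (0, false) (p ^ s),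
      isPGroup_multiplicative_zmod p s, fun h => ?_⟩
    · have h1 : SurfaceGroup.degree (0, false) (coverHom g k) = 1 := by
        refine Subgroup.mem_bot.1 (FreeGroup.map_mem_of_forall_of
          ((SurfaceGroup.degree (0, false)).comp (coverHom g)) ?_ k)
        rintro (_ | ⟨m, y⟩)
        · rw [MonoidHom.comp_apply, coverHom_of_none, SurfaceGroup.degree_gen_of_ne (by simp)]
          exact one_mem _
        · rw [MonoidHom.comp_apply, coverHom_of_some, map_mul, map_mul, map_inv,
            SurfaceGroup.degree_gen_of_ne (x := (y.1.succ, y.2)) (by simp [Fin.succ_ne_zero])]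
          simp
      have h2 : ((n : ℤ) : ZMod (p ^ s)) = 0 := by
        rw [SurfaceGroup.degreeMod_apply, map_mul, map_zpow, h1, SurfaceGroup.degree_gen_self,
          one_mul, ← ofAdd_zsmul, toAdd_ofAdd] at h
        simpa using h
      have h3 := Int.natAbs_dvd_natAbs.2 ((ZMod.intCast_zmod_eq_zero_iff_dvd _ _).1 h2)
      rw [Int.natAbs_natCast] at h3
      exact absurd (Nat.le_of_dvd (Int.natAbs_pos.2 hn) h3)
        (not_le.2 (Nat.lt_pow_self hp.one_lt))

end Residual

theorem exists_forall_of_finite {α T : Type*} [Group T] {good : Subgroup T → Prop}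
    (htop : good ⊤) (hinf : ∀ N N', good N → good N' → good (N ⊓ N'))
    {C : α → Subgroup T → Prop} (hC : ∀ w N N', N ≤ N' → C w N → C w N') {P : Set α}
    (hP : P.Finite) (h : ∀ N, good N → ∃ w ∈ P, C w N) : ∃ w ∈ P, ∀ N, good N → C w N := by
  by_contra! hcon
  have key : ∃ N, good N ∧ ∀ w ∈ P, ¬ C w N := by
    clear h
    induction P, hP using Set.Finite.induction_on with
    | empty => exact ⟨⊤, htop, fun w hw => hw.elim⟩
    | @insert w P _ _ ih =>
      obtain ⟨N, hN, hNP⟩ := ih fun w' hw' => hcon w' (Set.mem_insert_of_mem _ hw')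
      obtain ⟨N', hN', hNw⟩ := hcon w (Set.mem_insert _ _)
      refine ⟨N ⊓ N', hinf _ _ hN hN', fun w' hw' hw => ?_⟩
      rcases Set.mem_insert_iff.1 hw' with rfl | hw''
      · exact hNw (hC _ _ _ inf_le_right hw)
      · exact hNP w' hw'' (hC _ _ _ inf_le_left hw)
  obtain ⟨N, hN, hNP⟩ := key
  obtain ⟨w, hw, hwN⟩ := h N hN
  exact hNP w hw hwN

theorem zpow_eq_zpow_of_intCast_eq {G : Type*} [Group G] {x : G} {q : ℕ} (hx : x ^ q = 1)
    {m n : ℤ} (h : (m : ZMod q) = n) : x ^ m = x ^ n := by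
  obtain ⟨c, hc⟩ := (ZMod.intCast_eq_intCast_iff_dvd_sub _ _ _).1 h
  rw [← sub_add_cancel n m, hc, zpow_add, zpow_mul, zpow_natCast, hx, one_zpow, one_mul]

theorem fix_p_power_index_normal_subgroups_implies_inner
    (g : ℕ) (hg : 2 ≤ g) (p : ℕ) (hp : p.Prime)
    (φ : SurfaceGroup g ≃* SurfaceGroup g)
    (hφ : ∀ N : Subgroup (SurfaceGroup g), N.Normal →
      (∃ k : ℕ, N.index = p ^ k) → Subgroup.map φ.toMonoidHom N = N) :
    ∃ t : SurfaceGroup g, ∀ x : SurfaceGroup g, φ x = t * x * t⁻¹ := by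
  have : Fact p.Prime := ⟨hp⟩
  have hφ' : ∀ N : Subgroup (SurfaceGroup g), N.Normal → (∃ k : ℕ, N.index = p ^ k) →
      ∀ x, φ.toMonoidHom x ∈ N ↔ x ∈ N := by
    intro N hN hk x
    constructor
    · intro hx
      rw [← hφ N hN hk] at hx
      obtain ⟨y, hy, hyx⟩ := hx
      rwa [← φ.injective hyx]
    · intro hx
      rw [← hφ N hN hk]
      exact ⟨x, hx, rfl⟩
  let i : Fin g := ⟨0, by omega⟩
  let i' : Fin g := ⟨1, by omega⟩
  have hi : i' ≠ i := by simp [i, i']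
  set a := SurfaceGroup.gen (i, true) with ha
  set b := SurfaceGroup.gen (i, false) with hb
  set a' := SurfaceGroup.gen (i', true) with ha'
  set b' := SurfaceGroup.gen (i', false) with hb'
  obtain ⟨P, hP, hPN⟩ := exists_finite_conj_mod (p := p) i φ.toMonoidHom
  obtain ⟨P', hP', hPN'⟩ := exists_finite_conj_mod (p := p) i' φ.toMonoidHom
  let good : Subgroup (SurfaceGroup g) → Prop := fun N => N.Normal ∧ ∃ k : ℕ, N.index = p ^ k
  have hinf : ∀ N N', good N → good N' → good (N ⊓ N') := by
    rintro N N' ⟨hN, hk⟩ ⟨hN', hk'⟩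
    exact ⟨inferInstance, exists_index_inf_eq_prime_pow hk hk'⟩
  obtain ⟨⟨u, v⟩, -, huv⟩ := exists_forall_of_finite (good := good)
    (P := P ×ˢ P') (C := fun w N => ∃ h : SurfaceGroup g, (∀ x, (h * x * h⁻¹)⁻¹ * φ x ∈ N) ∧
      ∃ j k l m : ℕ, h⁻¹ * (w.1 * b ^ j * a ^ k) ∈ N ∧ h⁻¹ * (w.2 * b' ^ l * a' ^ m) ∈ N)
    ⟨inferInstance, 0, by simp⟩ hinf
    (fun w N N' hle ⟨h, h1, j, k, l, m, h2, h3⟩ =>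
      ⟨h, fun x => hle (h1 x), j, k, l, m, hle h2, hle h3⟩)
    (hP.prod hP') (by
      rintro N ⟨hN, hk⟩
      obtain ⟨M, hM, hMk, hMN, h1⟩ := hPN N hk
      obtain ⟨M', hM', hMk', hMN', h2⟩ := hPN' N hk
      obtain ⟨h, hh⟩ := exists_eq_conj_mod hg φ.toMonoidHom hφ' (M ⊓ M')
        (exists_index_inf_eq_prime_pow hMk hMk')
      have hh' : ∀ x, (h * x * h⁻¹)⁻¹ * φ x ∈ M ⊓ M' := fun x => QuotientGroup.eq.1 (hh x).symm
      obtain ⟨w, hw, j, k, h3⟩ := h1 h fun x => (hh' x).1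
      obtain ⟨w', hw', l, m, h4⟩ := h2 h fun x => (hh' x).2
      exact ⟨(w, w'), ⟨hw, hw'⟩, h, fun x => hMN (hh' x).1, j, k, l, m, QuotientGroup.eq.1 h3,
        QuotientGroup.eq.1 h4⟩)
  let e : Bool → ℤ := fun c => (SurfaceGroup.degree (i, c) v).toAdd -
    (SurfaceGroup.degree (i, c) u).toAdd
  let t := u * b ^ e false * a ^ e true
  have ht : ∀ N, good N → ∀ x, (t * x * t⁻¹)⁻¹ * φ x ∈ N := by
    rintro N ⟨hN, s, hs⟩ x
    have : NeZero (p ^ s) := ⟨pow_ne_zero _ hp.ne_zero⟩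
    have hD : ∀ c, good (SurfaceGroup.degreeMod (i, c) (p ^ s)).ker := fun c =>
      ⟨inferInstance, exists_index_ker_eq_prime_pow (isPGroup_multiplicative_zmod p s) _⟩
    obtain ⟨h, h1, j, k, l, m, h2, h3⟩ := huv _ (hinf _ _ ⟨hN, s, hs⟩
      (hinf _ _ (hD true) (hD false)))
    have hpow : ∀ y : SurfaceGroup g, (y : SurfaceGroup g ⧸ N) ^ p ^ s = 1 := by
      intro y
      rw [← hs]
      exact pow_card_eq_one'
    have hdeg : ∀ c, SurfaceGroup.degreeMod (i, c) (p ^ s) (u * b ^ j * a ^ k) =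
        SurfaceGroup.degreeMod (i, c) (p ^ s) (v * b' ^ l * a' ^ m) := by
      intro c
      have h4 : SurfaceGroup.degreeMod (i, c) (p ^ s) (h⁻¹ * (u * b ^ j * a ^ k)) = 1 ∧
          SurfaceGroup.degreeMod (i, c) (p ^ s) (h⁻¹ * (v * b' ^ l * a' ^ m)) = 1 := by
        cases c
        · exact ⟨h2.2.2, h3.2.2⟩
        · exact ⟨h2.2.1, h3.2.1⟩
      rw [map_mul, map_mul _ h⁻¹] at h4
      exact mul_left_cancel (h4.1.trans h4.2.symm)
    have ha0 : ∀ c, SurfaceGroup.degree (i, c) a' = 1 := fun c =>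
      SurfaceGroup.degree_gen_of_ne (by simp [hi])
    have hb0 : ∀ c, SurfaceGroup.degree (i, c) b' = 1 := fun c =>
      SurfaceGroup.degree_gen_of_ne (by simp [hi])
    have hk : ((k : ℤ) : ZMod (p ^ s)) = (e true : ℤ) := by
      have h5 := hdeg true
      simp only [SurfaceGroup.degreeMod_apply, map_mul, map_pow, ha0, hb0,
        SurfaceGroup.degree_gen_self, ha, hb,
        SurfaceGroup.degree_gen_of_ne (x := (i, false)) (y := (i, true)) (by simp)] at h5
      have h6 := Multiplicative.ofAdd.injective h5
      simp only [toAdd_mul, toAdd_pow, toAdd_ofAdd, toAdd_one, nsmul_eq_mul, Int.cast_zero,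
        Int.cast_one, mul_zero, add_zero, mul_one] at h6
      push_cast [e]
      linear_combination h6
    have hj : ((j : ℤ) : ZMod (p ^ s)) = (e false : ℤ) := by
      have h5 := hdeg false
      simp only [SurfaceGroup.degreeMod_apply, map_mul, map_pow, ha0, hb0,
        SurfaceGroup.degree_gen_self, ha, hb,
        SurfaceGroup.degree_gen_of_ne (x := (i, true)) (y := (i, false)) (by simp)] at h5
      have h6 := Multiplicative.ofAdd.injective h5
      simp only [toAdd_mul, toAdd_pow, toAdd_ofAdd, toAdd_one, nsmul_eq_mul, Int.cast_zero,
        Int.cast_one, mul_zero, add_zero, mul_one] at h6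
      push_cast [e]
      linear_combination h6
    have hht : (h : SurfaceGroup g ⧸ N) = t := by
      rw [QuotientGroup.eq.2 h2.1]
      change (u : SurfaceGroup g ⧸ N) * (b : SurfaceGroup g ⧸ N) ^ j *
        (a : SurfaceGroup g ⧸ N) ^ k = (u : SurfaceGroup g ⧸ N) *
          (b : SurfaceGroup g ⧸ N) ^ e false * (a : SurfaceGroup g ⧸ N) ^ e true
      rw [← zpow_eq_zpow_of_intCast_eq (hpow b) hj, ← zpow_eq_zpow_of_intCast_eq (hpow a) hk,
        zpow_natCast, zpow_natCast]
    rw [← QuotientGroup.eq, ← QuotientGroup.eq.2 (h1 x).1]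
    change (t : SurfaceGroup g ⧸ N) * x * (t : SurfaceGroup g ⧸ N)⁻¹ =
      (h : SurfaceGroup g ⧸ N) * x * (h : SurfaceGroup g ⧸ N)⁻¹
    rw [hht]
  refine ⟨t, fun x => ?_⟩
  by_contra hne
  obtain ⟨n, rfl⟩ : ∃ n, g = n + 1 := ⟨g - 1, by omega⟩
  obtain ⟨Q, _, _, f, hQ, hf⟩ := exists_hom_surfaceGroup_ne_one hp
    (t := (t * x * t⁻¹)⁻¹ * φ x) fun h1 => hne (inv_mul_eq_one.1 h1).symm
  exact hf (ht f.ker ⟨inferInstance, exists_index_ker_eq_prime_pow hQ f⟩ x)
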